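/- Let γ ≥ 1/2 and set p_γ = 4 if γ > 1 and p_γ = 8/(3−2γ) if γ ∈ [1/2,1]. Let 0 < T ≤ 1 and let u, v belong to L^{p_γ}([0,T]; H^{γ + 2/p_γ}). Then the Duhamel integral 𝓑(u,v)(t) = ∫₀^t e^{(t−s)Δ} Q(u,v)(s) ds defines an element of C([0,T]; H^γ) ∩ L²((0,T); Ḣ^{γ+1}), and there is a constant C depending only on γ (and the coefficients α of Q) such that: ‖𝓑(u,v)‖_{L^∞_T(H^γ)} + ‖∇𝓑(u,v)‖_{L²_T(H^γ)} ≤ C_γ(T) ‖u‖_{L^{p_γ}_T(H^{γ+2/p_γ})} ‖v‖_{L^{p_γ}_T(H^{γ+2/p_γ})} and ‖𝓑(u,v)‖_{L^{p_γ}_T(H^{γ+2/p_γ})} ≤ C_γ(T)(1 + T^{1/p_γ}) ‖u‖_{L^{p_γ}_T(H^{γ+2/p_γ})} ‖v‖_{L^{p_γ}_T(H^{γ+2/p_γ})}, where C_γ(T) = C T^{1/4} if γ > 1 and C_γ(T) = C T^{1/2 − 2/p_γ} if γ ∈ [1/2,1]. -/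

import Mathlib

noncomputable section

open MeasureTheory Set Filter
open scoped ENNReal Topology

/-- Frequency space ℝ³ (as functions `Fin 3 → ℝ`, with the product Lebesgue measure). -/
abbrev V3 : Type := Fin 3 → ℝ

/-- The Euclidean norm on `V3`. -/
def en (ξ : V3) : ℝ := Real.sqrt (∑ i, ξ i ^ 2)

/-- Squared Euclidean magnitude of a vector in ℂ³. -/
def vnSq (v : Fin 3 → ℂ) : ℝ := ∑ j, ‖v j‖ ^ 2

/-- Weighted L²-norm in the frequency variable, valued in `ℝ≥0∞`:
`wnorm w f = ( ∫ (w ξ)² |f ξ|² dξ )^{1/2}`. -/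
def wnorm (w : V3 → ℝ) (f : V3 → Fin 3 → ℂ) : ℝ≥0∞ :=
  (∫⁻ ξ : V3, ENNReal.ofReal (w ξ ^ 2 * vnSq (f ξ))) ^ ((1 : ℝ) / 2)

/-- Weight of the inhomogeneous Sobolev norm `H^γ`, i.e. `⟨ξ⟩^γ`. -/
def wH (γ : ℝ) : V3 → ℝ := fun ξ => (1 + en ξ ^ 2) ^ (γ / 2)

/-- Weight of the homogeneous Sobolev norm `Ḣ^s`, i.e. `|ξ|^s`. -/
def wD (s : ℝ) : V3 → ℝ := fun ξ => en ξ ^ s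

/-- Coefficients `α^{j,m,n,p}_{k,ℓ}` of the bilinear form `Q`
(order of arguments: `α j m n p k l`). -/
abbrev Coeffs : Type := Fin 3 → Fin 3 → Fin 3 → Fin 3 → Fin 3 → Fin 3 → ℝ

/-- The symbol `q^{j,m}_{k,ℓ}(ξ) = Σ_{n,p} α^{j,m,n,p}_{k,ℓ} ξ_n ξ_p / |ξ|²`. -/
def qsym (α : Coeffs) (j m k l : Fin 3) (ξ : V3) : ℝ :=
  ∑ n, ∑ p, α j m n p k l * (ξ n * ξ p) / en ξ ^ 2

/-- Fourier side of the bilinear term `Q(u,v)`: with the convention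
`f̂(ξ) = ∫ f(x) e^{-ix·ξ} dx`, the product `u^k v^ℓ` has Fourier transform
`(2π)⁻³ (û^k ∗ v̂^ℓ)(ξ)`, so that
`(Q^j(u,v))^(ξ) = Σ_{k,ℓ,m} q^{j,m}_{k,ℓ}(ξ) · iξ_m · (2π)⁻³ (û^k ∗ v̂^ℓ)(ξ)`. -/
def Qhat (α : Coeffs) (U W : V3 → Fin 3 → ℂ) : V3 → Fin 3 → ℂ := fun ξ j =>
  ∑ k : Fin 3, ∑ l : Fin 3, ∑ m : Fin 3,
    (qsym α j m k l ξ : ℂ) * (Complex.I * (ξ m : ℂ)) *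
      ((((2 * Real.pi) ^ (3 : ℕ))⁻¹ : ℝ) : ℂ) * ∫ η : V3, U η k * W (ξ - η) l

/-- `U` is (the Fourier transform of) a mild solution of the generalized Navier–Stokes
equations on `[0,T]` with (Fourier-side) data `U₀`:
`û(t,ξ) = e^{-t|ξ|²} û₀(ξ) + ∫₀^t e^{-(t-s)|ξ|²} (Q(u,u))^(s,ξ) ds`. -/
def IsMildSol (α : Coeffs) (U₀ : V3 → Fin 3 → ℂ) (U : ℝ → V3 → Fin 3 → ℂ) (T : ℝ) : Prop :=
  ∀ t ∈ Icc (0 : ℝ) T, ∀ ξ : V3, ∀ j : Fin 3,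
    U t ξ j = (Real.exp (-(t * en ξ ^ 2)) : ℂ) * U₀ ξ j
      + ∫ s in (0 : ℝ)..t, (Real.exp (-((t - s) * en ξ ^ 2)) : ℂ) * Qhat α (U s) (U s) ξ j

/-- Continuity on `[0,T]` with values in the weighted L²-space with weight `w`
(this encodes `u ∈ C([0,T]; H)` for the corresponding Sobolev space `H`). -/
def ContInW (w : V3 → ℝ) (U : ℝ → V3 → Fin 3 → ℂ) (T : ℝ) : Prop :=
  (∀ t ∈ Icc (0 : ℝ) T, wnorm w (U t) < ⊤) ∧
  ∀ t ∈ Icc (0 : ℝ) T, ∀ ε : ℝ≥0∞, 0 < ε → ∃ d > (0 : ℝ), ∀ s ∈ Icc (0 : ℝ) T,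
    |s - t| < d → wnorm w (fun ξ j => U s ξ j - U t ξ j) < ε

/-- Membership in `L²((0,T); H)` for the weighted space `H` with weight `w`. -/
def MemL2W (w : V3 → ℝ) (U : ℝ → V3 → Fin 3 → ℂ) (T : ℝ) : Prop :=
  ∫⁻ t in Ioo (0 : ℝ) T, wnorm w (U t) ^ (2 : ℕ) < ⊤

/-- Joint measurability of a time-dependent (Fourier-side) vector field. -/
def MeasVF (U : ℝ → V3 → Fin 3 → ℂ) : Prop :=
  ∀ j : Fin 3, Measurable (Function.uncurry fun t ξ => U t ξ j)

/-- Divergence-free condition on the Fourier side: `ξ · û₀(ξ) = 0`. -/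
def DivFree (U₀ : V3 → Fin 3 → ℂ) : Prop := ∀ ξ : V3, ∑ j : Fin 3, (ξ j : ℂ) * U₀ ξ j = 0

/-- `U₀` is the Fourier transform of a real (ℝ³-valued) vector field. -/
def RealField (U₀ : V3 → Fin 3 → ℂ) : Prop :=
  ∀ ξ : V3, ∀ j : Fin 3, U₀ (-ξ) j = (starRingEnd ℂ) (U₀ ξ j)

/-- The exponent `p_γ`. -/
def pgam (γ : ℝ) : ℝ := if 1 < γ then 4 else 8 / (3 - 2 * γ)

/-- The `L^p((0,T); H)` norm for the weighted space `H` with weight `w`. -/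
def LpTW (p T : ℝ) (w : V3 → ℝ) (A : ℝ → V3 → Fin 3 → ℂ) : ℝ≥0∞ :=
  (∫⁻ t in Ioo (0 : ℝ) T, wnorm w (A t) ^ p) ^ (1 / p)

/-- The Duhamel term `𝓑(u,v)(t) = ∫₀^t e^{(t-s)Δ} Q(u,v)(s) ds`, on the Fourier side. -/
def Bhat (α : Coeffs) (Uu Vv : ℝ → V3 → Fin 3 → ℂ) : ℝ → V3 → Fin 3 → ℂ :=
  fun t ξ j =>
    ∫ s in (0 : ℝ)..t, (Real.exp (-((t - s) * en ξ ^ 2)) : ℂ) * Qhat α (Uu s) (Vv s) ξ j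

/-- The squared Japanese bracket `⟨ξ⟩² = 1 + |ξ|²`. -/
def jb (ξ : V3) : ℝ := 1 + en ξ ^ 2

lemma en_nonneg (ξ : V3) : 0 ≤ en ξ := Real.sqrt_nonneg _

lemma en_sq (ξ : V3) : en ξ ^ 2 = ∑ i, ξ i ^ 2 :=
  Real.sq_sqrt (Finset.sum_nonneg fun _ _ => sq_nonneg _)

lemma abs_apply_le_en (ξ : V3) (i : Fin 3) : |ξ i| ≤ en ξ := by
  refine abs_le_of_sq_le_sq ?_ (en_nonneg ξ)
  rw [en_sq]
  exact Finset.single_le_sum (f := fun i => ξ i ^ 2) (fun _ _ => sq_nonneg _) (Finset.mem_univ i)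

lemma norm_le_en (ξ : V3) : ‖ξ‖ ≤ en ξ :=
  (pi_norm_le_iff_of_nonneg (en_nonneg ξ)).2 fun i => abs_apply_le_en ξ i

lemma measurable_en : Measurable en := by
  unfold en
  fun_prop

lemma measurable_jb : Measurable jb := (measurable_en.pow_const 2).const_add 1

lemma one_le_jb (ξ : V3) : 1 ≤ jb ξ := by
  unfold jb
  nlinarith [sq_nonneg (en ξ)]

lemma jb_pos (ξ : V3) : 0 < jb ξ := one_pos.trans_le (one_le_jb ξ)

lemma jb_le_add (ξ η : V3) : jb ξ ≤ 2 * jb η + 2 * jb (ξ - η) := by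
  simp only [jb, en_sq, Fin.sum_univ_three, Pi.sub_apply]
  nlinarith [sq_nonneg (2 * η 0 - ξ 0), sq_nonneg (2 * η 1 - ξ 1), sq_nonneg (2 * η 2 - ξ 2)]

lemma sq_norm_le_jb (ξ : V3) : ‖ξ‖ ^ 2 ≤ jb ξ := by
  have := pow_le_pow_left₀ (norm_nonneg ξ) (norm_le_en ξ) 2
  unfold jb
  linarith

/-- The kernel controlling the Sobolev product estimate after symmetrization. -/
def convKer (s : ℝ) (ξ η : V3) : ℝ := jb η ^ (-s) * max (jb ξ / 4) (jb η) ^ (-s)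

lemma jb_mul_jb_le {s : ℝ} (hs : 0 ≤ s) (ξ η : V3) :
    jb η ^ (-s) * jb (ξ - η) ^ (-s) ≤ convKer s ξ η + convKer s ξ (ξ - η) := by
  have key : ∀ x y : ℝ, 0 < x → x ≤ y → jb ξ ≤ 2 * x + 2 * y →
      x ^ (-s) * y ^ (-s) ≤ x ^ (-s) * max (jb ξ / 4) x ^ (-s) := by
    intro x y hx hxy h
    refine mul_le_mul_of_nonneg_left ?_ (Real.rpow_nonneg hx.le _)
    exact Real.rpow_le_rpow_of_nonpos (lt_max_of_lt_right hx) (max_le (by linarith) hxy)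
      (by linarith)
  have hnn : ∀ ζ, 0 ≤ convKer s ξ ζ := fun ζ =>
    mul_nonneg (Real.rpow_nonneg (jb_pos ζ).le _)
      (Real.rpow_nonneg ((jb_pos ζ).le.trans (le_max_right _ _)) _)
  have h := jb_le_add ξ η
  rcases le_total (jb η) (jb (ξ - η)) with hle | hle
  · exact (key _ _ (jb_pos η) hle h).trans (le_add_of_nonneg_right (hnn _))
  · rw [mul_comm]
    exact (key _ _ (jb_pos _) hle (by linarith)).trans (le_add_of_nonneg_left (hnn _))

lemma lintegral_jb_mul_jb_le {s : ℝ} (hs : 0 ≤ s) (ξ : V3) :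
    ∫⁻ η, ENNReal.ofReal (jb η ^ (-s)) * ENNReal.ofReal (jb (ξ - η) ^ (-s))
      ≤ 2 * ∫⁻ η, ENNReal.ofReal (convKer s ξ η) := by
  have hm : Measurable fun η => ENNReal.ofReal (convKer s ξ η) := by
    unfold convKer
    have := measurable_jb
    fun_prop
  calc _ ≤ ∫⁻ η, (ENNReal.ofReal (convKer s ξ η) + ENNReal.ofReal (convKer s ξ (ξ - η))) := by
        refine lintegral_mono fun η => ?_
        rw [← ENNReal.ofReal_mul (Real.rpow_nonneg (jb_pos η).le _)]
        exact (ENNReal.ofReal_le_ofReal (jb_mul_jb_le hs ξ η)).trans ENNReal.ofReal_add_le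
    _ = _ := by
        rw [lintegral_add_left hm,
          lintegral_sub_left_eq_self (fun η => ENNReal.ofReal (convKer s ξ η)) ξ, two_mul]

lemma lintegral_convKer_le_of_three_halves_lt {s : ℝ} (hs : 3 / 2 < s) :
    ∃ C : ℝ, 0 ≤ C ∧ ∀ ξ : V3,
      ∫⁻ η, ENNReal.ofReal (convKer s ξ η) ≤ ENNReal.ofReal (C * jb ξ ^ (-s)) := by
  have hint : Integrable (fun η : V3 => (1 + ‖η‖ ^ 2) ^ (-(2 * s) / 2)) :=
    integrable_rpow_neg_one_add_norm_sq (by simp; linarith)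
  have hnn : ∀ η : V3, 0 ≤ (1 + ‖η‖ ^ 2) ^ (-(2 * s) / 2) := fun η => by positivity
  refine ⟨(∫ η : V3, (1 + ‖η‖ ^ 2) ^ (-(2 * s) / 2)) * (1 / 4) ^ (-s),
    mul_nonneg (integral_nonneg hnn) (by positivity), fun ξ => ?_⟩
  have h4 : 0 < jb ξ / 4 := by linarith [jb_pos ξ]
  rw [mul_assoc, ← Real.mul_rpow (by norm_num) (jb_pos ξ).le,
    ENNReal.ofReal_mul (integral_nonneg hnn),
    ofReal_integral_eq_lintegral_ofReal hint (Eventually.of_forall hnn),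
    ← lintegral_mul_const' _ _ ENNReal.ofReal_ne_top]
  refine lintegral_mono fun η => ?_
  rw [← ENNReal.ofReal_mul (hnn η)]
  refine ENNReal.ofReal_le_ofReal (mul_le_mul ?_ ?_ (by positivity) (hnn η))
  · rw [show -(2 * s) / 2 = -s by ring]
    refine Real.rpow_le_rpow_of_nonpos (by positivity) ?_ (by linarith)
    have := pow_le_pow_left₀ (norm_nonneg η) (norm_le_en η) 2
    unfold jb
    linarith
  · refine Real.rpow_le_rpow_of_nonpos (by linarith) ?_ (by linarith)
    exact le_trans (by linarith) (le_max_left _ _)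

lemma integrableOn_mul_max_rpow {a ρ : ℝ} (ha : a < 3) (ha' : 3 < 2 * a) (hρ : 0 < ρ) :
    IntegrableOn (fun y : ℝ => y ^ 2 * (y ^ (-a) * max ρ y ^ (-a))) (Ioi 0) ∧
      ∫ y in Ioi (0 : ℝ), y ^ 2 * (y ^ (-a) * max ρ y ^ (-a))
        = ((3 - a)⁻¹ + (2 * a - 3)⁻¹) * ρ ^ (3 - 2 * a) := by
  have e1 : EqOn (fun y : ℝ => y ^ (2 - a) * ρ ^ (-a))
      (fun y : ℝ => y ^ 2 * (y ^ (-a) * max ρ y ^ (-a))) (Ioc 0 ρ) := fun y hy => by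
    simp only
    rw [max_eq_left hy.2, ← mul_assoc, sub_eq_add_neg, Real.rpow_add hy.1, Real.rpow_two]
  have e2 : EqOn (fun y : ℝ => y ^ (2 - 2 * a))
      (fun y : ℝ => y ^ 2 * (y ^ (-a) * max ρ y ^ (-a))) (Ioi ρ) := fun y hy => by
    have hy0 : 0 < y := hρ.trans hy
    simp only
    rw [max_eq_right (le_of_lt hy), ← Real.rpow_add hy0, ← Real.rpow_two, ← Real.rpow_add hy0]
    congr 1
    ring
  have i1 : IntegrableOn (fun y : ℝ => y ^ (2 - a) * ρ ^ (-a)) (Ioc 0 ρ) :=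
    ((intervalIntegrable_iff_integrableOn_Ioc_of_le hρ.le).1
      (intervalIntegral.intervalIntegrable_rpow' (by linarith))).mul_const _
  have i2 : IntegrableOn (fun y : ℝ => y ^ (2 - 2 * a)) (Ioi ρ) :=
    integrableOn_Ioi_rpow_of_lt (by linarith) hρ
  have i1' := i1.congr_fun e1 measurableSet_Ioc
  have i2' := i2.congr_fun e2 measurableSet_Ioi
  rw [← Ioc_union_Ioi_eq_Ioi hρ.le]
  refine ⟨i1'.union i2', ?_⟩
  rw [setIntegral_union (Ioc_disjoint_Ioi le_rfl) measurableSet_Ioi i1' i2',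
    ← setIntegral_congr_fun measurableSet_Ioc e1, ← setIntegral_congr_fun measurableSet_Ioi e2,
    integral_mul_const, ← intervalIntegral.integral_of_le hρ.le,
    integral_rpow (Or.inl (by linarith)), integral_Ioi_rpow_of_lt (by linarith) hρ,
    Real.zero_rpow (by linarith), show 2 - a + 1 = 3 - a by ring,
    show 2 - 2 * a + 1 = -(2 * a - 3) by ring, neg_div_neg_eq, sub_zero, div_mul_eq_mul_div,
    ← Real.rpow_add hρ, show 3 - a + -a = 3 - 2 * a by ring, neg_sub, add_mul]
  ring

lemma lintegral_convKer_le_of_lt_three_halves {s : ℝ} (hs : 3 / 4 < s) (hs' : s < 3 / 2) :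
    ∃ C : ℝ, 0 ≤ C ∧ ∀ ξ : V3,
      ∫⁻ η, ENNReal.ofReal (convKer s ξ η) ≤ ENNReal.ofReal (C * jb ξ ^ (-(2 * s - 3 / 2))) := by
  have h3 : 0 ≤ (3 - 2 * s)⁻¹ + (2 * (2 * s) - 3)⁻¹ :=
    add_nonneg (inv_nonneg.2 (by linarith)) (inv_nonneg.2 (by linarith))
  refine ⟨3 * ((volume : Measure V3).real (Metric.ball 0 1) *
    (((3 - 2 * s)⁻¹ + (2 * (2 * s) - 3)⁻¹) * (1 / 2) ^ (3 - 2 * (2 * s)))), by positivity,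
    fun ξ => ?_⟩
  set ρ : ℝ := √(jb ξ) / 2 with hρdef
  have hρ : 0 < ρ := by
    have := Real.sqrt_pos.2 (jb_pos ξ)
    positivity
  have hρ2 : ρ ^ 2 = jb ξ / 4 := by
    rw [hρdef, div_pow, Real.sq_sqrt (jb_pos ξ).le]
    norm_num
  obtain ⟨hi, hv⟩ := integrableOn_mul_max_rpow (a := 2 * s) (by linarith) (by linarith) hρ
  have hfr : Module.finrank ℝ V3 = 3 := by simp
  have hint : Integrable (fun η : V3 => ‖η‖ ^ (-(2 * s)) * max ρ ‖η‖ ^ (-(2 * s))) := by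
    rw [integrable_fun_norm_addHaar volume (f := fun y => y ^ (-(2 * s)) * max ρ y ^ (-(2 * s))),
      hfr]
    exact hi
  have hval : ∫ η : V3, ‖η‖ ^ (-(2 * s)) * max ρ ‖η‖ ^ (-(2 * s)) =
      3 * ((volume : Measure V3).real (Metric.ball 0 1) *
        (((3 - 2 * s)⁻¹ + (2 * (2 * s) - 3)⁻¹) * ρ ^ (3 - 2 * (2 * s)))) := by
    rw [integral_fun_norm_addHaar volume (fun y => y ^ (-(2 * s)) * max ρ y ^ (-(2 * s))), hfr,
      ← hv]
    simp
  have hρpow : ρ ^ (3 - 2 * (2 * s)) =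
      (1 / 2) ^ (3 - 2 * (2 * s)) * jb ξ ^ (-(2 * s - 3 / 2)) := by
    rw [hρdef, div_eq_inv_mul, Real.mul_rpow (by norm_num) (Real.sqrt_nonneg _),
      Real.sqrt_eq_rpow, ← Real.rpow_mul (jb_pos ξ).le, ← one_div]
    congr 2
    ring
  have hsq : ∀ x : ℝ, 0 ≤ x → (x ^ 2) ^ (-s) = x ^ (-(2 * s)) := fun x hx => by
    rw [← Real.rpow_two, ← Real.rpow_mul hx]
    congr 1
    ring
  calc ∫⁻ η, ENNReal.ofReal (convKer s ξ η)
      ≤ ∫⁻ η : V3, ENNReal.ofReal (‖η‖ ^ (-(2 * s)) * max ρ ‖η‖ ^ (-(2 * s))) := by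
        have hne : ∀ᵐ η : V3, η ≠ 0 := compl_mem_ae_iff.2 (measure_singleton 0)
        refine lintegral_mono_ae (hne.mono fun η hη => ENNReal.ofReal_le_ofReal ?_)
        have hη' : 0 < ‖η‖ := norm_pos_iff.2 hη
        have hmx : 0 ≤ max ρ ‖η‖ := hρ.le.trans (le_max_left _ _)
        rw [← hsq _ hη'.le, ← hsq _ hmx]
        refine mul_le_mul ?_ ?_ (Real.rpow_nonneg ((jb_pos η).le.trans (le_max_right _ _)) _)
          (by positivity)
        · exact Real.rpow_le_rpow_of_nonpos (by positivity) (sq_norm_le_jb η) (by linarith)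
        · refine Real.rpow_le_rpow_of_nonpos (pow_pos (lt_max_of_lt_left hρ) 2) ?_ (by linarith)
          rcases max_choice ρ ‖η‖ with h | h <;> rw [h]
          · rw [hρ2]
            exact le_max_left _ _
          · exact (sq_norm_le_jb η).trans (le_max_right _ _)
    _ = _ := by
        rw [← ofReal_integral_eq_lintegral_ofReal hint
          (Eventually.of_forall fun η => by positivity), hval, hρpow]
        congr 1
        ring

lemma vnSq_nonneg (v : Fin 3 → ℂ) : 0 ≤ vnSq v := Finset.sum_nonneg fun _ _ => sq_nonneg _

/-- The Euclidean magnitude of a vector in `ℂ³`, valued in `ℝ≥0∞`. -/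
def magn (v : Fin 3 → ℂ) : ℝ≥0∞ := ENNReal.ofReal (√(vnSq v))

lemma magn_sq (v : Fin 3 → ℂ) : magn v ^ 2 = ENNReal.ofReal (vnSq v) := by
  rw [magn, ← ENNReal.ofReal_pow (Real.sqrt_nonneg _), Real.sq_sqrt (vnSq_nonneg v)]

lemma magn_sq_eq_sum (v : Fin 3 → ℂ) : magn v ^ 2 = ∑ j, ‖v j‖ₑ ^ 2 := by
  rw [magn_sq, vnSq, ENNReal.ofReal_sum_of_nonneg fun _ _ => sq_nonneg _]
  refine Finset.sum_congr rfl fun j _ => ?_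
  rw [ENNReal.ofReal_pow (norm_nonneg _), ofReal_norm]

lemma enorm_apply_le_magn (v : Fin 3 → ℂ) (j : Fin 3) : ‖v j‖ₑ ≤ magn v := by
  rw [← ofReal_norm]
  refine ENNReal.ofReal_le_ofReal (Real.le_sqrt_of_sq_le ?_)
  exact Finset.single_le_sum (f := fun i => ‖v i‖ ^ 2) (fun _ _ => sq_nonneg _) (Finset.mem_univ j)

lemma measurable_magn_comp {β : Type*} [MeasurableSpace β] {f : β → Fin 3 → ℂ}
    (hf : ∀ j, Measurable fun x => f x j) : Measurable fun x => magn (f x) := by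
  unfold magn vnSq
  fun_prop

lemma wnorm_sq (w : V3 → ℝ) (f : V3 → Fin 3 → ℂ) :
    wnorm w f ^ 2 = ∫⁻ ξ, ENNReal.ofReal (w ξ ^ 2) * magn (f ξ) ^ 2 := by
  rw [wnorm, ← ENNReal.rpow_natCast, ← ENNReal.rpow_mul]
  norm_num
  refine lintegral_congr fun ξ => ?_
  rw [magn_sq, ENNReal.ofReal_mul (sq_nonneg _)]

lemma wH_sq (γ : ℝ) (ξ : V3) : wH γ ξ ^ 2 = jb ξ ^ γ := by
  change (jb ξ ^ (γ / 2)) ^ 2 = jb ξ ^ γ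
  rw [← Real.rpow_two, ← Real.rpow_mul (jb_pos ξ).le]
  congr 1
  ring

lemma sq_lintegral_le {β : Type*} [MeasurableSpace β] {μ : Measure β} {f g h : β → ℝ≥0∞}
    (hf : AEMeasurable f μ) (hg : AEMeasurable g μ) (H : ∀ x, h x ^ 2 ≤ f x * g x) :
    (∫⁻ x, h x ∂μ) ^ 2 ≤ (∫⁻ x, f x ∂μ) * ∫⁻ x, g x ∂μ := by
  have h1 : ∫⁻ x, h x ∂μ ≤ (∫⁻ x, f x ∂μ) ^ (1 / 2 : ℝ) * (∫⁻ x, g x ∂μ) ^ (1 / 2 : ℝ) := by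
    refine le_trans (lintegral_mono fun x => ?_)
      (ENNReal.lintegral_mul_norm_pow_le hf hg (by norm_num) (by norm_num) (by norm_num))
    rw [← ENNReal.mul_rpow_of_nonneg _ _ (by norm_num)]
    refine le_trans (le_of_eq ?_) (ENNReal.rpow_le_rpow (H x) (by norm_num))
    rw [← ENNReal.rpow_natCast, ← ENNReal.rpow_mul]
    norm_num
  refine (pow_le_pow_left' h1 2).trans (le_of_eq ?_)
  rw [← ENNReal.mul_rpow_of_nonneg _ _ (by norm_num), ← ENNReal.rpow_natCast, ← ENNReal.rpow_mul]
  norm_num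

/-- The convolution of the magnitudes of two (Fourier-side) vector fields. -/
def convMagn (U W : V3 → Fin 3 → ℂ) (ξ : V3) : ℝ≥0∞ := ∫⁻ η, magn (U η) * magn (W (ξ - η))

lemma exists_lintegral_convMagn_le {s σ : ℝ} (hs : 0 ≤ s)
    (h : ∃ C : ℝ, 0 ≤ C ∧ ∀ ξ : V3,
      ∫⁻ η, ENNReal.ofReal (convKer s ξ η) ≤ ENNReal.ofReal (C * jb ξ ^ (-σ))) :
    ∃ C : ℝ, 0 ≤ C ∧ ∀ U W : V3 → Fin 3 → ℂ, (∀ j, Measurable fun ξ => U ξ j) →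
      (∀ j, Measurable fun ξ => W ξ j) →
      ∫⁻ ξ, ENNReal.ofReal (jb ξ ^ σ) * convMagn U W ξ ^ 2
        ≤ ENNReal.ofReal C * (wnorm (wH s) U ^ 2 * wnorm (wH s) W ^ 2) := by
  obtain ⟨C, hC, hker⟩ := h
  refine ⟨2 * C, by positivity, fun U W hU hW => ?_⟩
  have hjb := measurable_jb
  obtain ⟨F, hF⟩ : ∃ F : V3 → ℝ≥0∞, F = fun ξ => ENNReal.ofReal (jb ξ ^ s) * magn (U ξ) ^ 2 :=
    ⟨_, rfl⟩
  obtain ⟨G, hG⟩ : ∃ G : V3 → ℝ≥0∞, G = fun ξ => ENNReal.ofReal (jb ξ ^ s) * magn (W ξ) ^ 2 :=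
    ⟨_, rfl⟩
  have hFm : Measurable F := hF ▸
    (hjb.pow_const s).ennreal_ofReal.mul ((measurable_magn_comp hU).pow_const 2)
  have hGm : Measurable G := hG ▸
    (hjb.pow_const s).ennreal_ofReal.mul ((measurable_magn_comp hW).pow_const 2)
  have hcancel : ∀ ξ, ENNReal.ofReal (jb ξ ^ (-s)) * ENNReal.ofReal (jb ξ ^ s) = 1 := fun ξ => by
    rw [← ENNReal.ofReal_mul (Real.rpow_nonneg (jb_pos ξ).le _), ← Real.rpow_add (jb_pos ξ)]
    simp
  have hpt : ∀ ξ, ENNReal.ofReal (jb ξ ^ σ) * convMagn U W ξ ^ 2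
      ≤ ENNReal.ofReal (2 * C) * ∫⁻ η, F η * G (ξ - η) := fun ξ => by
    have hcs : convMagn U W ξ ^ 2 ≤
        (∫⁻ η, ENNReal.ofReal (jb η ^ (-s)) * ENNReal.ofReal (jb (ξ - η) ^ (-s))) *
          ∫⁻ η, F η * G (ξ - η) := by
      refine sq_lintegral_le (Measurable.aemeasurable (by fun_prop))
        (hFm.mul (hGm.comp (measurable_const.sub measurable_id))).aemeasurable fun η => le_of_eq ?_
      calc (magn (U η) * magn (W (ξ - η))) ^ 2
          = (ENNReal.ofReal (jb η ^ (-s)) * ENNReal.ofReal (jb η ^ s)) *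
            (ENNReal.ofReal (jb (ξ - η) ^ (-s)) * ENNReal.ofReal (jb (ξ - η) ^ s)) *
            (magn (U η) * magn (W (ξ - η))) ^ 2 := by rw [hcancel, hcancel]; simp
        _ = _ := by
          simp only [hF, hG]
          ring
    calc _ ≤ ENNReal.ofReal (jb ξ ^ σ) *
          ((2 * ENNReal.ofReal (C * jb ξ ^ (-σ))) * ∫⁻ η, F η * G (ξ - η)) := by
          gcongr
          refine hcs.trans ?_
          gcongr
          refine (lintegral_jb_mul_jb_le hs ξ).trans ?_
          gcongr
          exact hker ξ
      _ = _ := by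
          rw [← mul_assoc]
          congr 1
          rw [show (2 : ℝ≥0∞) = ENNReal.ofReal 2 by simp, ← ENNReal.ofReal_mul (by norm_num),
            ← ENNReal.ofReal_mul (Real.rpow_nonneg (jb_pos ξ).le _)]
          congr 1
          rw [Real.rpow_neg (jb_pos ξ).le]
          have := (Real.rpow_pos_of_pos (jb_pos ξ) σ).ne'
          field_simp
  calc _ ≤ ∫⁻ ξ, ENNReal.ofReal (2 * C) * ∫⁻ η, F η * G (ξ - η) := lintegral_mono hpt
    _ = ENNReal.ofReal (2 * C) * ∫⁻ η, ∫⁻ ξ, F η * G (ξ - η) := by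
        rw [lintegral_const_mul' _ _ ENNReal.ofReal_ne_top, lintegral_lintegral_swap]
        exact ((hFm.comp measurable_snd).mul
          (hGm.comp (measurable_fst.sub measurable_snd))).aemeasurable
    _ = ENNReal.ofReal (2 * C) * ((∫⁻ η, F η) * ∫⁻ ξ, G ξ) := by
        congr 1
        rw [← lintegral_mul_const _ hFm]
        refine lintegral_congr fun η => ?_
        rw [lintegral_const_mul (f := fun ξ => G (ξ - η)) _ (hGm.comp (measurable_id.sub_const η)),
          lintegral_sub_right_eq_self G η]
    _ = _ := by
        simp only [wnorm_sq, wH_sq, hF, hG]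

/-- A positive bound for all the symbols of the bilinear form `Q`. -/
def coeffBound (α : Coeffs) : ℝ := 1 + ∑ j, ∑ k, ∑ l, ∑ m, ∑ n, ∑ p, |α j m n p k l|

lemma abs_qsym_le (α : Coeffs) (j m k l : Fin 3) (ξ : V3) :
    |qsym α j m k l ξ| ≤ ∑ n, ∑ p, |α j m n p k l| := by
  refine (Finset.abs_sum_le_sum_abs _ _).trans (Finset.sum_le_sum fun n _ => ?_)
  refine (Finset.abs_sum_le_sum_abs _ _).trans (Finset.sum_le_sum fun p _ => ?_)
  rw [mul_div_assoc, abs_mul]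
  refine mul_le_of_le_one_right (abs_nonneg _) ?_
  rw [abs_div, abs_mul, abs_of_nonneg (sq_nonneg (en ξ)), sq]
  exact div_le_one_of_le₀ (mul_le_mul (abs_apply_le_en ξ n) (abs_apply_le_en ξ p)
    (abs_nonneg _) (en_nonneg ξ)) (mul_self_nonneg _)

lemma enorm_Qhat_le (α : Coeffs) (U W : V3 → Fin 3 → ℂ) (ξ : V3) (j : Fin 3) :
    ‖Qhat α U W ξ j‖ₑ ≤
      ENNReal.ofReal (coeffBound α) * (ENNReal.ofReal (en ξ) * convMagn U W ξ) := by
  have hc : ((2 * Real.pi) ^ 3)⁻¹ ≤ 1 :=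
    inv_le_one_of_one_le₀ (one_le_pow₀ (by linarith [Real.pi_gt_three]))
  have hterm : ∀ k l m, ‖(qsym α j m k l ξ : ℂ) * (Complex.I * (ξ m : ℂ)) *
      ((((2 * Real.pi) ^ (3 : ℕ))⁻¹ : ℝ) : ℂ) * ∫ η : V3, U η k * W (ξ - η) l‖ₑ ≤
      ENNReal.ofReal (∑ n, ∑ p, |α j m n p k l|) *
        (ENNReal.ofReal (en ξ) * convMagn U W ξ) := fun k l m => by
    rw [enorm_mul, ← mul_assoc (ENNReal.ofReal _)]
    gcongr
    · rw [← ofReal_norm, ← ENNReal.ofReal_mul (by positivity)]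
      refine ENNReal.ofReal_le_ofReal ?_
      rw [norm_mul, norm_mul, norm_mul, Complex.norm_I, one_mul, Complex.norm_real,
        Complex.norm_real, Complex.norm_real, Real.norm_eq_abs, Real.norm_eq_abs,
        Real.norm_of_nonneg (by positivity)]
      refine (mul_le_of_le_one_right (by positivity) hc).trans ?_
      exact mul_le_mul (abs_qsym_le α j m k l ξ) (abs_apply_le_en ξ m) (abs_nonneg _)
        (by positivity)
    · refine (enorm_integral_le_lintegral_enorm _).trans (lintegral_mono fun η => ?_)
      rw [enorm_mul]
      exact mul_le_mul' (enorm_apply_le_magn _ _) (enorm_apply_le_magn _ _)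
  calc ‖Qhat α U W ξ j‖ₑ ≤ ∑ k, ∑ l, ∑ m, ENNReal.ofReal (∑ n, ∑ p, |α j m n p k l|) *
        (ENNReal.ofReal (en ξ) * convMagn U W ξ) := by
        refine (enorm_sum_le _ _).trans (Finset.sum_le_sum fun k _ => ?_)
        refine (enorm_sum_le _ _).trans (Finset.sum_le_sum fun l _ => ?_)
        exact (enorm_sum_le _ _).trans (Finset.sum_le_sum fun m _ => hterm k l m)
    _ = ENNReal.ofReal (∑ k, ∑ l, ∑ m, ∑ n, ∑ p, |α j m n p k l|) *
        (ENNReal.ofReal (en ξ) * convMagn U W ξ) := by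
        simp only [← Finset.sum_mul]
        congr 1
        rw [ENNReal.ofReal_sum_of_nonneg fun _ _ => by positivity]
        refine Finset.sum_congr rfl fun k _ => ?_
        rw [ENNReal.ofReal_sum_of_nonneg fun _ _ => by positivity]
        refine Finset.sum_congr rfl fun l _ => ?_
        rw [ENNReal.ofReal_sum_of_nonneg fun _ _ => by positivity]
    _ ≤ _ := by
        gcongr
        refine le_add_of_nonneg_of_le zero_le_one ?_
        exact Finset.single_le_sum
          (f := fun j => ∑ k, ∑ l, ∑ m, ∑ n, ∑ p, |α j m n p k l|)
          (fun _ _ => by positivity) (Finset.mem_univ j)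

lemma mul_lintegral_exp_sub_left {a b c : ℝ} (ha : 0 ≤ a) (hbc : b ≤ c) :
    ENNReal.ofReal a * ∫⁻ s in Ioc b c, ENNReal.ofReal (Real.exp (-((c - s) * a)))
      = ENNReal.ofReal (1 - Real.exp (-((c - b) * a))) := by
  have hd : ∀ s ∈ uIcc b c, HasDerivAt (fun s => Real.exp (-((c - s) * a)))
      (a * Real.exp (-((c - s) * a))) s := fun s _ => by
    have h := ((((hasDerivAt_id s).const_sub c).mul_const a).neg).exp
    simpa [mul_comm] using h
  have hcont : Continuous fun s => a * Real.exp (-((c - s) * a)) := by fun_prop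
  have hint := intervalIntegral.integral_eq_sub_of_hasDerivAt hd (hcont.intervalIntegrable b c)
  rw [← lintegral_const_mul' _ _ ENNReal.ofReal_ne_top]
  simp_rw [← ENNReal.ofReal_mul ha]
  rw [← ofReal_integral_eq_lintegral_ofReal (hcont.integrableOn_Ioc)
    (Eventually.of_forall fun s => by positivity), ← intervalIntegral.integral_of_le hbc, hint]
  simp

lemma mul_lintegral_exp_sub_right {a b c : ℝ} (ha : 0 ≤ a) (hbc : b ≤ c) :
    ENNReal.ofReal a * ∫⁻ t in Ioc b c, ENNReal.ofReal (Real.exp (-((t - b) * a)))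
      = ENNReal.ofReal (1 - Real.exp (-((c - b) * a))) := by
  have hd : ∀ t ∈ uIcc b c, HasDerivAt (fun t => -Real.exp (-((t - b) * a)))
      (a * Real.exp (-((t - b) * a))) t := fun t _ => by
    have h := ((((hasDerivAt_id t).sub_const b).mul_const a).neg).exp.neg
    exact h.congr_deriv (by simp [mul_comm])
  have hcont : Continuous fun t => a * Real.exp (-((t - b) * a)) := by fun_prop
  have hint := intervalIntegral.integral_eq_sub_of_hasDerivAt hd (hcont.intervalIntegrable b c)
  rw [← lintegral_const_mul' _ _ ENNReal.ofReal_ne_top]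
  simp_rw [← ENNReal.ofReal_mul ha]
  rw [← ofReal_integral_eq_lintegral_ofReal (hcont.integrableOn_Ioc)
    (Eventually.of_forall fun s => by positivity), ← intervalIntegral.integral_of_le hbc, hint]
  congr 1
  simp
  ring

lemma one_sub_exp_neg_le_rpow {x y δ : ℝ} (hx : 0 ≤ x) (hxy : x ≤ y) (hδ : 0 ≤ δ) (hδ1 : δ ≤ 1) :
    1 - Real.exp (-x) ≤ y ^ δ := by
  rcases le_total 1 y with hy | hy
  · linarith [Real.one_le_rpow hy hδ, Real.exp_pos (-x)]
  · have h1 : y ≤ y ^ δ := Real.self_le_rpow_of_le_one (hx.trans hxy) hy hδ1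
    linarith [Real.add_one_le_exp (-x)]

/-- The time convolution of the heat kernel with the squared magnitude of the forcing. -/
def heatSq (G : ℝ → V3 → ℝ≥0∞) (t : ℝ) (ξ : V3) : ℝ≥0∞ :=
  ∫⁻ s in Ioc 0 t, ENNReal.ofReal (Real.exp (-((t - s) * en ξ ^ 2))) * G s ξ ^ 2

lemma heatSq_le (G : ℝ → V3 → ℝ≥0∞) {t T : ℝ} (htT : t ≤ T) (ξ : V3) :
    heatSq G t ξ ≤ ∫⁻ s in Ioc 0 T, G s ξ ^ 2 := by
  calc heatSq G t ξ ≤ ∫⁻ s in Ioc 0 t, G s ξ ^ 2 := by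
        refine setLIntegral_mono' measurableSet_Ioc fun s hs => ?_
        refine mul_le_of_le_one_left' ?_
        rw [ENNReal.ofReal_le_one, Real.exp_le_one_iff, neg_nonpos]
        exact mul_nonneg (sub_nonneg.2 hs.2) (sq_nonneg _)
    _ ≤ _ := lintegral_mono_set (Ioc_subset_Ioc_right htT)

lemma measurable_heatSq_integrand {G : ℝ → V3 → ℝ≥0∞} (hG : Measurable (Function.uncurry G)) :
    Measurable fun z : (ℝ × V3) × ℝ =>
      ENNReal.ofReal (Real.exp (-((z.1.1 - z.2) * en z.1.2 ^ 2))) * G z.2 z.1.2 ^ 2 := by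
  have h1 : Measurable fun z : (ℝ × V3) × ℝ => en z.1.2 :=
    measurable_en.comp (measurable_snd.comp measurable_fst)
  have h2 : Measurable fun z : (ℝ × V3) × ℝ => G z.2 z.1.2 :=
    hG.comp (measurable_snd.prodMk (measurable_snd.comp measurable_fst))
  fun_prop

lemma mul_lintegral_heatSq_le {G : ℝ → V3 → ℝ≥0∞} (hG : Measurable (Function.uncurry G))
    {T δ : ℝ} (hδ : 0 ≤ δ) (hδ1 : δ ≤ 1) (ξ : V3) :
    ENNReal.ofReal (en ξ ^ 2) * ∫⁻ t in Ioc 0 T, heatSq G t ξ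
      ≤ ENNReal.ofReal ((T * en ξ ^ 2) ^ δ) * ∫⁻ s in Ioc 0 T, G s ξ ^ 2 := by
  set k : ℝ → ℝ → ℝ≥0∞ := fun t s =>
    ENNReal.ofReal (Real.exp (-((t - s) * en ξ ^ 2))) * G s ξ ^ 2 with hk
  have hkm : Measurable (Function.uncurry k) :=
    (measurable_heatSq_integrand hG).comp
      (f := fun z : ℝ × ℝ => (((z.1, ξ), z.2) : (ℝ × V3) × ℝ)) (by fun_prop)
  have hGξ : Measurable fun s => G s ξ ^ 2 :=
    (hG.comp (measurable_id.prodMk measurable_const)).pow_const 2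
  have hset : MeasurableSet {z : ℝ × ℝ | z.2 ≤ z.1} := measurableSet_le measurable_snd measurable_fst
  have hkm' : Measurable (Function.uncurry fun t s => if s ≤ t then k t s else 0) :=
    Measurable.ite hset hkm measurable_const
  have e1 : ∀ t ∈ Ioc 0 T, heatSq G t ξ = ∫⁻ s in Ioc 0 T, if s ≤ t then k t s else 0 := by
    intro t ht
    have : Ioc 0 t = Iic t ∩ Ioc 0 T := by
      ext s
      simp only [mem_Ioc, mem_inter_iff, mem_Iic]
      exact ⟨fun h => ⟨h.2, h.1, h.2.trans ht.2⟩, fun h => ⟨h.2.1, h.1⟩⟩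
    rw [heatSq, this, ← Measure.restrict_restrict measurableSet_Iic,
      ← lintegral_indicator measurableSet_Iic]
    rfl
  have e2 : ∀ s ∈ Ioc 0 T, ENNReal.ofReal (en ξ ^ 2) * ∫⁻ t in Ioc 0 T, (if s ≤ t then k t s else 0)
      ≤ ENNReal.ofReal ((T * en ξ ^ 2) ^ δ) * G s ξ ^ 2 := by
    intro s hs
    have : Icc s T = Ici s ∩ Ioc 0 T := by
      ext t
      simp only [mem_Ioc, mem_inter_iff, mem_Ici, mem_Icc]
      exact ⟨fun h => ⟨h.1, hs.1.trans_le h.1, h.2⟩, fun h => ⟨h.1, h.2.2⟩⟩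
    have e3 : ∫⁻ t in Ioc 0 T, (if s ≤ t then k t s else 0) = ∫⁻ t in Ioc s T, k t s := by
      rw [setLIntegral_congr (Ioc_ae_eq_Icc (a := s) (b := T)), this,
        ← Measure.restrict_restrict measurableSet_Ici, ← lintegral_indicator measurableSet_Ici]
      rfl
    rw [e3, hk, lintegral_mul_const _ (by fun_prop), ← mul_assoc,
      mul_lintegral_exp_sub_right (sq_nonneg _) hs.2]
    gcongr
    refine one_sub_exp_neg_le_rpow (mul_nonneg (sub_nonneg.2 hs.2) (sq_nonneg _)) ?_ hδ hδ1
    gcongr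
    linarith [hs.1]
  rw [setLIntegral_congr_fun measurableSet_Ioc e1, lintegral_lintegral_swap hkm'.aemeasurable,
    ← lintegral_const_mul' _ _ ENNReal.ofReal_ne_top,
    ← lintegral_const_mul' _ _ ENNReal.ofReal_ne_top]
  exact setLIntegral_mono' measurableSet_Ioc e2

/-- The magnitude of the forcing term at time `t`. -/
def forcing (Uu Vv : ℝ → V3 → Fin 3 → ℂ) (t : ℝ) (ξ : V3) : ℝ≥0∞ := convMagn (Uu t) (Vv t) ξ

section Measurability

variable {Uu Vv : ℝ → V3 → Fin 3 → ℂ}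

lemma MeasVF.measurable_slice (hU : MeasVF Uu) (t : ℝ) (j : Fin 3) :
    Measurable fun ξ => Uu t ξ j :=
  (hU j).comp (measurable_const.prodMk measurable_id)

lemma measurable_forcing (hU : MeasVF Uu) (hV : MeasVF Vv) :
    Measurable (Function.uncurry (forcing Uu Vv)) := by
  have h1 : Measurable fun z : (ℝ × V3) × V3 => magn (Uu z.1.1 z.2) :=
    measurable_magn_comp fun j => (hU j).comp
      (f := fun z : (ℝ × V3) × V3 => (z.1.1, z.2)) (by fun_prop)
  have h2 : Measurable fun z : (ℝ × V3) × V3 => magn (Vv z.1.1 (z.1.2 - z.2)) :=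
    measurable_magn_comp fun j => (hV j).comp
      (f := fun z : (ℝ × V3) × V3 => (z.1.1, z.1.2 - z.2)) (by fun_prop)
  exact (h1.mul h2).lintegral_prod_right'

lemma measurable_Qhat (α : Coeffs) (hU : MeasVF Uu) (hV : MeasVF Vv) (j : Fin 3) :
    Measurable fun z : ℝ × V3 => Qhat α (Uu z.1) (Vv z.1) z.2 j := by
  have hconv : ∀ k l, Measurable fun z : ℝ × V3 => ∫ η : V3, Uu z.1 η k * Vv z.1 (z.2 - η) l := by
    intro k l
    have h1 : Measurable fun z : (ℝ × V3) × V3 => Uu z.1.1 z.2 k :=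
      (hU k).comp (f := fun z : (ℝ × V3) × V3 => (z.1.1, z.2)) (by fun_prop)
    have h2 : Measurable fun z : (ℝ × V3) × V3 => Vv z.1.1 (z.1.2 - z.2) l :=
      (hV l).comp (f := fun z : (ℝ × V3) × V3 => (z.1.1, z.1.2 - z.2)) (by fun_prop)
    exact (StronglyMeasurable.integral_prod_right
      (f := fun (z : ℝ × V3) (η : V3) => Uu z.1 η k * Vv z.1 (z.2 - η) l)
      (h1.mul h2).stronglyMeasurable).measurable
  have hq : ∀ k l m, Measurable fun z : ℝ × V3 => qsym α j m k l z.2 := fun k l m => by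
    have hen : Measurable fun z : ℝ × V3 => en z.2 := measurable_en.comp measurable_snd
    refine Finset.measurable_fun_sum _ fun n _ => Finset.measurable_fun_sum _ fun p _ => ?_
    exact Measurable.div (by fun_prop) (hen.pow_const 2)
  unfold Qhat
  refine Finset.measurable_fun_sum _ fun k _ => Finset.measurable_fun_sum _ fun l _ =>
    Finset.measurable_fun_sum _ fun m _ => ?_
  refine Measurable.mul (Measurable.mul_const (Measurable.mul ?_ ?_) _) (hconv k l)
  · exact Complex.measurable_ofReal.comp (hq k l m)
  · fun_prop

lemma measurable_Bhat (α : Coeffs) (hU : MeasVF Uu) (hV : MeasVF Vv) {t : ℝ} (ht : 0 ≤ t)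
    (j : Fin 3) : Measurable fun ξ => Bhat α Uu Vv t ξ j := by
  have hQ : Measurable fun z : V3 × ℝ => Qhat α (Uu z.2) (Vv z.2) z.1 j :=
    Measurable.comp (g := fun z : ℝ × V3 => Qhat α (Uu z.1) (Vv z.1) z.2 j)
      (f := fun z : V3 × ℝ => (z.2, z.1)) (measurable_Qhat α hU hV j) measurable_swap
  have hen := measurable_en
  unfold Bhat
  simp_rw [intervalIntegral.integral_of_le ht]
  refine (StronglyMeasurable.integral_prod_right (f := fun (ξ : V3) (s : ℝ) =>
    (Real.exp (-((t - s) * en ξ ^ 2)) : ℂ) * Qhat α (Uu s) (Vv s) ξ j) ?_).measurable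
  refine Measurable.stronglyMeasurable (Measurable.mul ?_ hQ)
  fun_prop

end Measurability

lemma coeffBound_pos (α : Coeffs) : 0 < coeffBound α := by
  unfold coeffBound
  positivity

lemma enorm_Bhat_le (α : Coeffs) (Uu Vv : ℝ → V3 → Fin 3 → ℂ) {t : ℝ} (ht : 0 ≤ t) (ξ : V3)
    (j : Fin 3) : ‖Bhat α Uu Vv t ξ j‖ₑ ≤ ENNReal.ofReal (coeffBound α) *
      (ENNReal.ofReal (en ξ) * ∫⁻ s in Ioc 0 t,
        ENNReal.ofReal (Real.exp (-((t - s) * en ξ ^ 2))) * forcing Uu Vv s ξ) := by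
  rw [Bhat, intervalIntegral.integral_of_le ht,
    ← lintegral_const_mul' _ _ ENNReal.ofReal_ne_top,
    ← lintegral_const_mul' _ _ ENNReal.ofReal_ne_top]
  refine (enorm_integral_le_lintegral_enorm _).trans (lintegral_mono fun s => ?_)
  rw [enorm_mul, ← ofReal_norm (E := ℂ) (Real.exp _ : ℂ), Complex.norm_real,
    Real.norm_of_nonneg (Real.exp_pos _).le]
  calc _ ≤ ENNReal.ofReal (Real.exp (-((t - s) * en ξ ^ 2))) *
        (ENNReal.ofReal (coeffBound α) * (ENNReal.ofReal (en ξ) * forcing Uu Vv s ξ)) := by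
        gcongr
        exact enorm_Qhat_le α (Uu s) (Vv s) ξ j
    _ = _ := by ring

lemma sq_lintegral_exp_mul_le {G : ℝ → V3 → ℝ≥0∞} {ξ : V3} (hG : Measurable fun s => G s ξ)
    (t : ℝ) :
    (∫⁻ s in Ioc 0 t, ENNReal.ofReal (Real.exp (-((t - s) * en ξ ^ 2))) * G s ξ) ^ 2 ≤
      (∫⁻ s in Ioc 0 t, ENNReal.ofReal (Real.exp (-((t - s) * en ξ ^ 2)))) * heatSq G t ξ := by
  have hem : Measurable fun s => ENNReal.ofReal (Real.exp (-((t - s) * en ξ ^ 2))) := by fun_prop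
  exact sq_lintegral_le hem.aemeasurable (hem.mul (hG.pow_const 2)).aemeasurable
    fun s => le_of_eq (by ring)

lemma magn_Bhat_sq_le (α : Coeffs) {Uu Vv : ℝ → V3 → Fin 3 → ℂ} (hU : MeasVF Uu) (hV : MeasVF Vv)
    {t T δ : ℝ} (ht : 0 ≤ t) (htT : t ≤ T) (hδ : 0 ≤ δ) (hδ1 : δ ≤ 1) (ξ : V3) :
    magn (Bhat α Uu Vv t ξ) ^ 2 ≤ ENNReal.ofReal (3 * coeffBound α ^ 2) *
      (ENNReal.ofReal ((T * en ξ ^ 2) ^ δ) * heatSq (forcing Uu Vv) t ξ) := by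
  have hGξ : Measurable fun s => forcing Uu Vv s ξ :=
    Measurable.comp (g := Function.uncurry (forcing Uu Vv)) (f := fun s => (s, ξ))
      (measurable_forcing hU hV) (by fun_prop)
  have hcs := sq_lintegral_exp_mul_le hGξ t
  have hker : ENNReal.ofReal (en ξ ^ 2) *
      ∫⁻ s in Ioc 0 t, ENNReal.ofReal (Real.exp (-((t - s) * en ξ ^ 2)))
      ≤ ENNReal.ofReal ((T * en ξ ^ 2) ^ δ) := by
    rw [mul_lintegral_exp_sub_left (sq_nonneg _) ht, sub_zero]
    exact ENNReal.ofReal_le_ofReal (one_sub_exp_neg_le_rpow (mul_nonneg ht (sq_nonneg _))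
      (mul_le_mul_of_nonneg_right htT (sq_nonneg _)) hδ hδ1)
  have hj : ∀ j, ‖Bhat α Uu Vv t ξ j‖ₑ ^ 2 ≤ ENNReal.ofReal (coeffBound α ^ 2) *
        (ENNReal.ofReal ((T * en ξ ^ 2) ^ δ) * heatSq (forcing Uu Vv) t ξ) := by
    intro j
    refine (pow_le_pow_left' (enorm_Bhat_le α Uu Vv ht ξ j) 2).trans ?_
    rw [mul_pow, mul_pow, ← ENNReal.ofReal_pow (coeffBound_pos α).le,
      ← ENNReal.ofReal_pow (en_nonneg ξ)]
    refine mul_le_mul_right ?_ _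
    refine (mul_le_mul_right hcs _).trans ?_
    rw [← mul_assoc]
    exact mul_le_mul_left hker _
  rw [magn_sq_eq_sum]
  refine (Finset.sum_le_sum fun j _ => hj j).trans_eq ?_
  rw [Finset.sum_const, Finset.card_univ, Fintype.card_fin, nsmul_eq_mul,
    ENNReal.ofReal_mul (by norm_num), mul_assoc]
  simp only [Nat.cast_ofNat, ENNReal.ofReal_ofNat]

lemma measurable_heatSq {G : ℝ → V3 → ℝ≥0∞} (hG : Measurable (Function.uncurry G)) :
    Measurable (Function.uncurry (heatSq G)) := by
  have hset : MeasurableSet {z : (ℝ × V3) × ℝ | z.2 ∈ Ioc 0 z.1.1} :=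
    (measurableSet_lt measurable_const measurable_snd).inter
      (measurableSet_le measurable_snd (measurable_fst.comp measurable_fst))
  have h : Function.uncurry (heatSq G) = fun x : ℝ × V3 => ∫⁻ s,
      {z : (ℝ × V3) × ℝ | z.2 ∈ Ioc 0 z.1.1}.indicator (fun z : (ℝ × V3) × ℝ =>
        ENNReal.ofReal (Real.exp (-((z.1.1 - z.2) * en z.1.2 ^ 2))) * G z.2 z.1.2 ^ 2) (x, s) := by
    funext x
    simp only [Function.uncurry, heatSq]
    rw [← lintegral_indicator measurableSet_Ioc]
    rfl
  rw [h]
  exact ((measurable_heatSq_integrand hG).indicator hset).lintegral_prod_right'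

/-- The time-integrated squared forcing at frequency `ξ`. -/
def forcingSq (Uu Vv : ℝ → V3 → Fin 3 → ℂ) (T : ℝ) (ξ : V3) : ℝ≥0∞ :=
  ∫⁻ s in Ioc 0 T, forcing Uu Vv s ξ ^ 2

/-- A time-independent majorant of the squared weighted magnitude of the Duhamel term. -/
def majorant (α : Coeffs) (Uu Vv : ℝ → V3 → Fin 3 → ℂ) (T γ δ : ℝ) (ξ : V3) : ℝ≥0∞ :=
  ENNReal.ofReal (3 * coeffBound α ^ 2) * (ENNReal.ofReal (T ^ δ) *
    (ENNReal.ofReal (jb ξ ^ (γ + δ)) * forcingSq Uu Vv T ξ))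

lemma ofReal_jb_rpow_mul_le {T : ℝ} (hT : 0 ≤ T) {δ : ℝ} (hδ : 0 ≤ δ) (γ : ℝ) (ξ : V3) :
    ENNReal.ofReal (jb ξ ^ γ) * ENNReal.ofReal ((T * en ξ ^ 2) ^ δ)
      ≤ ENNReal.ofReal (T ^ δ) * ENNReal.ofReal (jb ξ ^ (γ + δ)) := by
  have h : (en ξ ^ 2) ^ δ ≤ jb ξ ^ δ :=
    Real.rpow_le_rpow (sq_nonneg _) (by unfold jb; linarith) hδ
  rw [← ENNReal.ofReal_mul (Real.rpow_nonneg (jb_pos ξ).le _),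
    ← ENNReal.ofReal_mul (Real.rpow_nonneg hT _), Real.mul_rpow hT (sq_nonneg _),
    Real.rpow_add (jb_pos ξ)]
  refine ENNReal.ofReal_le_ofReal ?_
  calc jb ξ ^ γ * (T ^ δ * (en ξ ^ 2) ^ δ) = T ^ δ * (jb ξ ^ γ * (en ξ ^ 2) ^ δ) := by ring
    _ ≤ _ := by
      have := Real.rpow_nonneg (jb_pos ξ).le γ
      gcongr

section Estimates

variable {Uu Vv : ℝ → V3 → Fin 3 → ℂ}

lemma measurable_forcingSq (hU : MeasVF Uu) (hV : MeasVF Vv) (T : ℝ) :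
    Measurable (forcingSq Uu Vv T) := by
  have h : Measurable fun z : V3 × ℝ => forcing Uu Vv z.2 z.1 ^ 2 :=
    (Measurable.comp (g := Function.uncurry (forcing Uu Vv)) (f := fun z : V3 × ℝ => (z.2, z.1))
      (measurable_forcing hU hV) (by fun_prop)).pow_const 2
  exact h.lintegral_prod_right'

lemma measurable_majorant (α : Coeffs) (hU : MeasVF Uu) (hV : MeasVF Vv) (T γ δ : ℝ) :
    Measurable (majorant α Uu Vv T γ δ) :=
  (((measurable_jb.pow_const _).ennreal_ofReal.mul
    (measurable_forcingSq hU hV T)).const_mul _).const_mul _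

lemma ofReal_mul_magn_Bhat_sq_le (α : Coeffs) (hU : MeasVF Uu) (hV : MeasVF Vv) {t T δ : ℝ}
    (ht : 0 ≤ t) (htT : t ≤ T) (hδ : 0 ≤ δ) (hδ1 : δ ≤ 1) (γ : ℝ) (ξ : V3) :
    ENNReal.ofReal (wH γ ξ ^ 2) * magn (Bhat α Uu Vv t ξ) ^ 2 ≤ majorant α Uu Vv T γ δ ξ := by
  rw [wH_sq]
  calc _ ≤ ENNReal.ofReal (jb ξ ^ γ) * (ENNReal.ofReal (3 * coeffBound α ^ 2) *
        (ENNReal.ofReal ((T * en ξ ^ 2) ^ δ) * forcingSq Uu Vv T ξ)) := by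
        gcongr
        refine (magn_Bhat_sq_le α hU hV ht htT hδ hδ1 ξ).trans ?_
        gcongr
        exact heatSq_le _ htT ξ
    _ = ENNReal.ofReal (3 * coeffBound α ^ 2) * ((ENNReal.ofReal (jb ξ ^ γ) *
        ENNReal.ofReal ((T * en ξ ^ 2) ^ δ)) * forcingSq Uu Vv T ξ) := by ring
    _ ≤ _ := by
        rw [majorant, ← mul_assoc (ENNReal.ofReal (T ^ δ))]
        exact mul_le_mul_right (mul_le_mul_left (ofReal_jb_rpow_mul_le (ht.trans htT) hδ γ ξ) _) _

lemma wnorm_Bhat_sq_le (α : Coeffs) (hU : MeasVF Uu) (hV : MeasVF Vv) {t T δ : ℝ}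
    (ht : 0 ≤ t) (htT : t ≤ T) (hδ : 0 ≤ δ) (hδ1 : δ ≤ 1) (γ : ℝ) :
    wnorm (wH γ) (Bhat α Uu Vv t) ^ 2 ≤ ∫⁻ ξ, majorant α Uu Vv T γ δ ξ := by
  rw [wnorm_sq]
  exact lintegral_mono fun ξ => ofReal_mul_magn_Bhat_sq_le α hU hV ht htT hδ hδ1 γ ξ

lemma lintegral_wnorm_Bhat_sq_le (α : Coeffs) (hU : MeasVF Uu) (hV : MeasVF Vv) {T δ : ℝ}
    (hT : 0 ≤ T) (hδ : 0 ≤ δ) (hδ1 : δ ≤ 1) (γ : ℝ) :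
    ∫⁻ t in Ioo 0 T, wnorm (fun ξ => wH γ ξ * en ξ) (Bhat α Uu Vv t) ^ 2
      ≤ ∫⁻ ξ, majorant α Uu Vv T γ δ ξ := by
  have hF := measurable_forcing hU hV
  have hH : Measurable fun z : ℝ × V3 => heatSq (forcing Uu Vv) z.1 z.2 := measurable_heatSq hF
  have hen := measurable_en
  have hjb := measurable_jb
  obtain ⟨c, hc⟩ : ∃ c : V3 → ℝ≥0∞, c = fun ξ => ENNReal.ofReal (3 * coeffBound α ^ 2) *
      (ENNReal.ofReal (jb ξ ^ γ) * ENNReal.ofReal ((T * en ξ ^ 2) ^ (δ / 2)) *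
        ENNReal.ofReal (en ξ ^ 2)) := ⟨_, rfl⟩
  have hcm : Measurable c := by
    rw [hc]
    fun_prop
  have hctop : ∀ ξ, c ξ ≠ ⊤ := fun ξ => by
    rw [hc]
    finiteness
  rw [setLIntegral_congr (Ioo_ae_eq_Ioc (a := (0 : ℝ)) (b := T))]
  calc _ ≤ ∫⁻ t in Ioc 0 T, ∫⁻ ξ, c ξ * heatSq (forcing Uu Vv) t ξ := by
        refine setLIntegral_mono' measurableSet_Ioc fun t ht => ?_
        rw [wnorm_sq]
        refine lintegral_mono fun ξ => ?_
        rw [mul_pow, ENNReal.ofReal_mul (sq_nonneg _), wH_sq]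
        refine (mul_le_mul_right (magn_Bhat_sq_le α hU hV ht.1.le ht.2
          (δ := δ / 2) (by linarith) (by linarith) ξ) _).trans (le_of_eq ?_)
        rw [hc]
        ring
    _ = ∫⁻ ξ, c ξ * ∫⁻ t in Ioc 0 T, heatSq (forcing Uu Vv) t ξ := by
        rw [lintegral_lintegral_swap ((hcm.comp measurable_snd).mul hH).aemeasurable]
        exact lintegral_congr fun ξ => lintegral_const_mul' _ _ (hctop ξ)
    _ ≤ _ := by
        refine lintegral_mono fun ξ => ?_
        calc c ξ * ∫⁻ t in Ioc 0 T, heatSq (forcing Uu Vv) t ξ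
            = ENNReal.ofReal (3 * coeffBound α ^ 2) *
              (ENNReal.ofReal (jb ξ ^ γ) * ENNReal.ofReal ((T * en ξ ^ 2) ^ (δ / 2)) *
              (ENNReal.ofReal (en ξ ^ 2) * ∫⁻ t in Ioc 0 T, heatSq (forcing Uu Vv) t ξ)) := by
              rw [hc]
              ring
          _ ≤ ENNReal.ofReal (3 * coeffBound α ^ 2) *
              (ENNReal.ofReal (jb ξ ^ γ) * ENNReal.ofReal ((T * en ξ ^ 2) ^ (δ / 2)) *
              (ENNReal.ofReal ((T * en ξ ^ 2) ^ (δ / 2)) * forcingSq Uu Vv T ξ)) := by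
              exact mul_le_mul_right (mul_le_mul_right
                (mul_lintegral_heatSq_le hF (by linarith) (by linarith) ξ) _) _
          _ = ENNReal.ofReal (3 * coeffBound α ^ 2) *
              (ENNReal.ofReal (jb ξ ^ γ) * ENNReal.ofReal ((T * en ξ ^ 2) ^ δ) *
                forcingSq Uu Vv T ξ) := by
              have hx : 0 ≤ T * en ξ ^ 2 := by positivity
              have : (T * en ξ ^ 2) ^ δ = (T * en ξ ^ 2) ^ (δ / 2) * (T * en ξ ^ 2) ^ (δ / 2) := by
                rw [← Real.rpow_add_of_nonneg hx (by linarith) (by linarith), add_halves]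
              rw [this, ENNReal.ofReal_mul (Real.rpow_nonneg hx _)]
              ring
          _ ≤ _ := by
              rw [majorant, ← mul_assoc (ENNReal.ofReal (T ^ δ))]
              exact mul_le_mul_right (mul_le_mul_left (ofReal_jb_rpow_mul_le hT hδ γ ξ) _) _

end Estimates

lemma measurable_wnorm {w : V3 → ℝ} (hw : Measurable w) {U : ℝ → V3 → Fin 3 → ℂ}
    (hU : MeasVF U) : Measurable fun t => wnorm w (U t) := by
  unfold wnorm
  refine Measurable.pow_const (Measurable.lintegral_prod_right'
    (f := fun z : ℝ × V3 => ENNReal.ofReal (w z.2 ^ 2 * vnSq (U z.1 z.2))) ?_) _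
  have h : ∀ j, Measurable fun z : ℝ × V3 => U z.1 z.2 j := hU
  have hw' : Measurable fun z : ℝ × V3 => w z.2 := hw.comp measurable_snd
  unfold vnSq
  fun_prop

lemma measurable_wH (γ : ℝ) : Measurable (wH γ) := measurable_jb.pow_const (γ / 2)

lemma lintegral_sq_mul_sq_le {T p : ℝ} (hT : 0 ≤ T) (hp : 4 ≤ p) {f g : ℝ → ℝ≥0∞}
    (hf : Measurable f) (hg : Measurable g) :
    ∫⁻ t in Ioc 0 T, f t ^ 2 * g t ^ 2 ≤ ENNReal.ofReal (T ^ (1 - 4 / p)) *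
      (((∫⁻ t in Ioo 0 T, f t ^ p) ^ (1 / p)) ^ 2 * ((∫⁻ t in Ioo 0 T, g t ^ p) ^ (1 / p)) ^ 2) := by
  have hp0 : 0 < p := by linarith
  have hμ : volume (Ioc 0 T) = ENNReal.ofReal T := by simp
  have hm : ∀ i ∈ (Finset.univ : Finset (Fin 3)), AEMeasurable
      ((![fun t => f t ^ p, fun t => g t ^ p, fun _ => 1] : Fin 3 → ℝ → ℝ≥0∞) i)
      (volume.restrict (Ioc 0 T)) := by
    intro i _
    fin_cases i
    · exact (hf.pow_const p).aemeasurable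
    · exact (hg.pow_const p).aemeasurable
    · exact aemeasurable_const
  have h4 : 4 / p ≤ 1 := (div_le_one hp0).2 hp
  have key := ENNReal.lintegral_prod_norm_pow_le (Finset.univ : Finset (Fin 3)) hm
    (p := ![2 / p, 2 / p, 1 - 4 / p]) (by simp [Fin.sum_univ_three]; ring) (by
      intro i _
      fin_cases i
      · exact (div_pos two_pos hp0).le
      · exact (div_pos two_pos hp0).le
      · exact sub_nonneg.2 h4)
  have hpow : ∀ x : ℝ≥0∞, (x ^ p) ^ (2 / p) = x ^ 2 := fun x => by
    rw [← ENNReal.rpow_mul, mul_div_cancel₀ _ hp0.ne', ENNReal.rpow_ofNat]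
  have hpow' : ∀ x : ℝ≥0∞, (x ^ (1 / p)) ^ 2 = x ^ (2 / p) := fun x => by
    rw [← ENNReal.rpow_mul_natCast]
    congr 1
    push_cast
    ring
  simp only [Fin.prod_univ_three, Matrix.cons_val_zero, Matrix.cons_val_one, Matrix.cons_val,
    ENNReal.one_rpow, mul_one, hpow, setLIntegral_one, hμ] at key
  rw [hpow', hpow', setLIntegral_congr (Ioo_ae_eq_Ioc (a := (0 : ℝ)) (b := T)),
    setLIntegral_congr (Ioo_ae_eq_Ioc (a := (0 : ℝ)) (b := T)),
    ← ENNReal.ofReal_rpow_of_nonneg hT (sub_nonneg.2 h4), mul_comm]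
  exact key

lemma exists_lintegral_majorant_le (α : Coeffs) {γ δ p s : ℝ} (hp : 4 ≤ p) (hs : 0 ≤ s)
    (h : ∃ C : ℝ, 0 ≤ C ∧ ∀ ξ : V3,
      ∫⁻ η, ENNReal.ofReal (convKer s ξ η) ≤ ENNReal.ofReal (C * jb ξ ^ (-(γ + δ)))) :
    ∃ K : ℝ, 0 ≤ K ∧ ∀ T : ℝ, 0 < T → ∀ Uu Vv : ℝ → V3 → Fin 3 → ℂ, MeasVF Uu → MeasVF Vv →
      ∫⁻ ξ, majorant α Uu Vv T γ δ ξ ≤ (ENNReal.ofReal (K * T ^ ((δ + 1 - 4 / p) / 2)) *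
        (LpTW p T (wH s) Uu * LpTW p T (wH s) Vv)) ^ 2 := by
  obtain ⟨C, hC, hconv⟩ := exists_lintegral_convMagn_le hs h
  have hK : 0 ≤ 3 * coeffBound α ^ 2 * C := by positivity
  refine ⟨√(3 * coeffBound α ^ 2 * C), Real.sqrt_nonneg _, fun T hT Uu Vv hU hV => ?_⟩
  have hF : Measurable fun z : V3 × ℝ => forcing Uu Vv z.2 z.1 :=
    Measurable.comp (g := Function.uncurry (forcing Uu Vv)) (f := fun z : V3 × ℝ => (z.2, z.1))
      (measurable_forcing hU hV) (by fun_prop)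
  have hjb := measurable_jb
  have hN : ∫⁻ ξ, ENNReal.ofReal (jb ξ ^ (γ + δ)) * forcingSq Uu Vv T ξ ≤
      ENNReal.ofReal C * (ENNReal.ofReal (T ^ (1 - 4 / p)) *
        (LpTW p T (wH s) Uu ^ 2 * LpTW p T (wH s) Vv ^ 2)) := by
    calc _ = ∫⁻ ξ, ∫⁻ t in Ioc 0 T,
          ENNReal.ofReal (jb ξ ^ (γ + δ)) * forcing Uu Vv t ξ ^ 2 :=
          lintegral_congr fun ξ => (lintegral_const_mul' _ _ ENNReal.ofReal_ne_top).symm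
      _ = ∫⁻ t in Ioc 0 T, ∫⁻ ξ, ENNReal.ofReal (jb ξ ^ (γ + δ)) * forcing Uu Vv t ξ ^ 2 := by
          refine lintegral_lintegral_swap (Measurable.aemeasurable ?_)
          exact Measurable.mul (by fun_prop) (hF.pow_const 2)
      _ ≤ ∫⁻ t in Ioc 0 T, ENNReal.ofReal C *
          (wnorm (wH s) (Uu t) ^ 2 * wnorm (wH s) (Vv t) ^ 2) :=
          lintegral_mono fun t => hconv (Uu t) (Vv t) (hU.measurable_slice t) (hV.measurable_slice t)
      _ ≤ _ := by
          rw [lintegral_const_mul' _ _ ENNReal.ofReal_ne_top]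
          exact mul_le_mul_right (lintegral_sq_mul_sq_le hT.le hp (measurable_wnorm (measurable_wH s) hU)
            (measurable_wnorm (measurable_wH s) hV)) _
  have e : ∫⁻ ξ, majorant α Uu Vv T γ δ ξ = ENNReal.ofReal (3 * coeffBound α ^ 2) *
      (ENNReal.ofReal (T ^ δ) * ∫⁻ ξ, ENNReal.ofReal (jb ξ ^ (γ + δ)) * forcingSq Uu Vv T ξ) := by
    unfold majorant
    rw [lintegral_const_mul' _ _ ENNReal.ofReal_ne_top,
      lintegral_const_mul' _ _ ENNReal.ofReal_ne_top]
  rw [e]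
  refine (mul_le_mul_right (mul_le_mul_right hN _) _).trans (le_of_eq ?_)
  have hsq : (√(3 * coeffBound α ^ 2 * C) * T ^ ((δ + 1 - 4 / p) / 2)) ^ 2
      = (3 * coeffBound α ^ 2) * (T ^ δ * (C * T ^ (1 - 4 / p))) := by
    rw [mul_pow, Real.sq_sqrt hK, ← Real.rpow_mul_natCast hT.le,
      show (δ + 1 - 4 / p) / 2 * (2 : ℕ) = δ + (1 - 4 / p) by push_cast; ring, Real.rpow_add hT]
    ring
  rw [mul_pow, ← ENNReal.ofReal_pow (by positivity), hsq,
    ENNReal.ofReal_mul (p := 3 * coeffBound α ^ 2) (by positivity),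
    ENNReal.ofReal_mul (p := T ^ δ) (by positivity), ENNReal.ofReal_mul hC]
  ring

lemma wnorm_rpow_le {γ p : ℝ} (hp : 2 ≤ p) {f : V3 → Fin 3 → ℂ}
    (hf : ∀ j, Measurable fun ξ => f ξ j) :
    wnorm (wH (γ + 2 / p)) f ^ p ≤ (wnorm (wH γ) f ^ 2) ^ (p / 2 - 1) *
      (wnorm (wH γ) f ^ 2 + wnorm (fun ξ => wH γ ξ * en ξ) f ^ 2) := by
  have hp0 : 0 < p := by linarith
  have h2p : 2 / p ≤ 1 := (div_le_one hp0).2 hp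
  have hjb := measurable_jb
  have hm := measurable_magn_comp hf
  have e1 : wnorm (wH γ) f ^ 2 = ∫⁻ ξ, ENNReal.ofReal (jb ξ ^ γ) * magn (f ξ) ^ 2 := by
    simp only [wnorm_sq, wH_sq]
  have e2 : wnorm (wH γ) f ^ 2 + wnorm (fun ξ => wH γ ξ * en ξ) f ^ 2
      = ∫⁻ ξ, ENNReal.ofReal (jb ξ ^ γ * jb ξ) * magn (f ξ) ^ 2 := by
    rw [e1, wnorm_sq, ← lintegral_add_left (by fun_prop)]
    refine lintegral_congr fun ξ => ?_
    rw [mul_pow, wH_sq, ← add_mul, ← ENNReal.ofReal_add (Real.rpow_nonneg (jb_pos ξ).le _)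
      (mul_nonneg (Real.rpow_nonneg (jb_pos ξ).le _) (sq_nonneg _))]
    congr 2
    unfold jb
    ring
  have hz : wnorm (wH (γ + 2 / p)) f ^ 2 ≤ (wnorm (wH γ) f ^ 2) ^ (1 - 2 / p) *
      (wnorm (wH γ) f ^ 2 + wnorm (fun ξ => wH γ ξ * en ξ) f ^ 2) ^ (2 / p) := by
    rw [e2, e1, wnorm_sq]
    refine le_trans (le_of_eq (lintegral_congr fun ξ => ?_)) (ENNReal.lintegral_mul_norm_pow_le
      (Measurable.aemeasurable (by fun_prop)) (Measurable.aemeasurable (by fun_prop))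
      (sub_nonneg.2 h2p) (by positivity) (sub_add_cancel _ _))
    have hpos := Real.rpow_pos_of_pos (jb_pos ξ) γ
    rw [ENNReal.mul_rpow_of_nonneg _ _ (sub_nonneg.2 h2p),
      ENNReal.mul_rpow_of_nonneg _ _ (by positivity), mul_mul_mul_comm,
      ← ENNReal.rpow_add_of_nonneg _ _ (sub_nonneg.2 h2p) (by positivity), sub_add_cancel,
      ENNReal.rpow_one, ENNReal.ofReal_rpow_of_pos hpos,
      ENNReal.ofReal_rpow_of_pos (mul_pos hpos (jb_pos ξ)),
      ← ENNReal.ofReal_mul (by positivity), Real.mul_rpow hpos.le (jb_pos ξ).le, ← mul_assoc,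
      ← Real.rpow_add hpos, sub_add_cancel, Real.rpow_one, wH_sq, Real.rpow_add (jb_pos ξ)]
  calc wnorm (wH (γ + 2 / p)) f ^ p = (wnorm (wH (γ + 2 / p)) f ^ 2) ^ (p / 2) := by
        rw [← ENNReal.rpow_natCast_mul]
        congr 1
        push_cast
        ring
    _ ≤ _ := by
        refine (ENNReal.rpow_le_rpow hz (by positivity)).trans (le_of_eq ?_)
        rw [ENNReal.mul_rpow_of_nonneg _ _ (by positivity), ← ENNReal.rpow_mul, ← ENNReal.rpow_mul,
          show (1 - 2 / p) * (p / 2) = p / 2 - 1 by field_simp,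
          show 2 / p * (p / 2) = 1 by field_simp, ENNReal.rpow_one]

lemma LpTW_le_of_energy {p T γ : ℝ} (hp : 2 ≤ p) (hT : 0 ≤ T) {B : ℝ → V3 → Fin 3 → ℂ}
    (hB : ∀ t ∈ Ioo 0 T, ∀ j, Measurable fun ξ => B t ξ j) {R : ℝ≥0∞} (hR : R ≠ ⊤)
    (hsup : ∀ t ∈ Ioo 0 T, wnorm (wH γ) (B t) ^ 2 ≤ R ^ 2)
    (hdis : ∫⁻ t in Ioo 0 T, wnorm (fun ξ => wH γ ξ * en ξ) (B t) ^ 2 ≤ R ^ 2) :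
    LpTW p T (wH (γ + 2 / p)) B ≤ ENNReal.ofReal (1 + T ^ (1 / p)) * R := by
  have hp0 : 0 < p := by linarith
  have hint : ∫⁻ t in Ioo 0 T, wnorm (wH (γ + 2 / p)) (B t) ^ p ≤
      R ^ p * (1 + ENNReal.ofReal T) := by
    calc _ ≤ ∫⁻ t in Ioo 0 T, (R ^ 2) ^ (p / 2 - 1) *
          (R ^ 2 + wnorm (fun ξ => wH γ ξ * en ξ) (B t) ^ 2) := by
          refine setLIntegral_mono' measurableSet_Ioo fun t ht => ?_
          refine (wnorm_rpow_le hp (hB t ht)).trans ?_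
          have := hsup t ht
          have h2 : 0 ≤ p / 2 - 1 := by linarith
          gcongr
      _ = (R ^ 2) ^ (p / 2 - 1) * (R ^ 2 * ENNReal.ofReal T +
          ∫⁻ t in Ioo 0 T, wnorm (fun ξ => wH γ ξ * en ξ) (B t) ^ 2) := by
          rw [lintegral_const_mul' _ _ (ENNReal.rpow_ne_top_of_nonneg (by linarith) (by finiteness)),
            lintegral_add_left measurable_const, setLIntegral_const, Real.volume_Ioo, sub_zero]
      _ ≤ (R ^ 2) ^ (p / 2 - 1) * (R ^ 2 * ENNReal.ofReal T + R ^ 2) := by gcongr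
      _ = (R ^ 2) ^ (p / 2 - 1) * (R ^ 2) ^ (1 : ℝ) * (1 + ENNReal.ofReal T) := by
          rw [ENNReal.rpow_one]
          ring
      _ = _ := by
          rw [← ENNReal.rpow_add_of_nonneg _ _ (by linarith) zero_le_one, sub_add_cancel,
            ← ENNReal.rpow_natCast_mul]
          congr 2
          push_cast
          ring
  calc LpTW p T (wH (γ + 2 / p)) B ≤ (R ^ p * (1 + ENNReal.ofReal T)) ^ (1 / p) :=
        ENNReal.rpow_le_rpow hint (by positivity)
    _ = R * (1 + ENNReal.ofReal T) ^ (1 / p) := by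
        rw [ENNReal.mul_rpow_of_nonneg _ _ (by positivity), ← ENNReal.rpow_mul,
          mul_one_div_cancel hp0.ne', ENNReal.rpow_one]
    _ ≤ R * (1 ^ (1 / p) + ENNReal.ofReal T ^ (1 / p)) := by
        gcongr
        exact ENNReal.rpow_add_le_add_rpow _ _ (by positivity)
          ((div_le_one hp0).2 (by linarith))
    _ = _ := by
        rw [ENNReal.one_rpow, ENNReal.ofReal_rpow_of_nonneg hT (by positivity), mul_comm,
          ENNReal.ofReal_add zero_le_one (by positivity), ENNReal.ofReal_one]

lemma wnorm_mono {w w' : V3 → ℝ} (h : ∀ ξ, w ξ ^ 2 ≤ w' ξ ^ 2) (f : V3 → Fin 3 → ℂ) :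
    wnorm w f ≤ wnorm w' f := by
  unfold wnorm
  refine ENNReal.rpow_le_rpow (lintegral_mono fun ξ => ENNReal.ofReal_le_ofReal ?_) (by norm_num)
  exact mul_le_mul_of_nonneg_right (h ξ) (vnSq_nonneg _)

lemma wD_sq_le {γ : ℝ} (hγ : 0 ≤ γ) (ξ : V3) : wD (γ + 1) ξ ^ 2 ≤ (wH γ ξ * en ξ) ^ 2 := by
  rw [wD, mul_pow, wH_sq, ← Real.rpow_mul_natCast (en_nonneg ξ),
    show (γ + 1) * (2 : ℕ) = 2 * γ + 2 by push_cast; ring,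
    Real.rpow_add_of_nonneg (en_nonneg ξ) (by linarith) (by norm_num), Real.rpow_two,
    Real.rpow_mul (en_nonneg ξ), Real.rpow_two]
  refine mul_le_mul_of_nonneg_right ?_ (sq_nonneg _)
  exact Real.rpow_le_rpow (sq_nonneg _) (by unfold jb; linarith) hγ

lemma le_of_sq_le_sq_ennreal {x R : ℝ≥0∞} (h : x ^ 2 ≤ R ^ 2) : x ≤ R :=
  (ENNReal.pow_le_pow_left_iff two_ne_zero).1 h

lemma forcingSq_lt_top_of_majorant {α : Coeffs} {Uu Vv : ℝ → V3 → Fin 3 → ℂ} {T γ δ : ℝ}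
    (hT : 0 < T) {ξ : V3} (h : majorant α Uu Vv T γ δ ξ < ⊤) : forcingSq Uu Vv T ξ < ⊤ := by
  have h0 : ∀ {c : ℝ} {x : ℝ≥0∞}, 0 < c → ENNReal.ofReal c * x < ⊤ → x < ⊤ := fun hc hx => by
    by_contra hn
    rw [not_lt_top_iff.1 hn, ENNReal.mul_top (ENNReal.ofReal_pos.2 hc).ne'] at hx
    exact lt_irrefl _ hx
  have hM := coeffBound_pos α
  exact h0 (Real.rpow_pos_of_pos (jb_pos ξ) _) (h0 (Real.rpow_pos_of_pos hT _)
    (h0 (c := 3 * coeffBound α ^ 2) (by positivity) h))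

section Continuity

variable {Uu Vv : ℝ → V3 → Fin 3 → ℂ}

lemma intervalIntegrable_exp_mul_Qhat (α : Coeffs) (hU : MeasVF Uu) (hV : MeasVF Vv) {T : ℝ}
    (hT : 0 ≤ T) {ξ : V3} (h : forcingSq Uu Vv T ξ < ⊤) (j : Fin 3) :
    IntervalIntegrable (fun s => (Real.exp (s * en ξ ^ 2) : ℂ) * Qhat α (Uu s) (Vv s) ξ j)
      volume 0 T := by
  have hQm : Measurable fun s => Qhat α (Uu s) (Vv s) ξ j :=
    Measurable.comp (g := fun z : ℝ × V3 => Qhat α (Uu z.1) (Vv z.1) z.2 j)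
      (f := fun s : ℝ => (s, ξ)) (measurable_Qhat α hU hV j) (by fun_prop)
  have hQ : IntervalIntegrable (fun s => Qhat α (Uu s) (Vv s) ξ j) volume 0 T := by
    rw [intervalIntegrable_iff_integrableOn_Ioc_of_le hT]
    refine ⟨hQm.aestronglyMeasurable, ?_⟩
    have hle : ∀ x : ℝ≥0∞, x ≤ 1 + x ^ 2 := fun x => by
      rcases le_total x 1 with hx | hx
      · exact hx.trans le_self_add
      · exact (le_self_pow₀ hx two_ne_zero).trans le_add_self
    calc ∫⁻ s in Ioc 0 T, ‖Qhat α (Uu s) (Vv s) ξ j‖ₑ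
        ≤ ∫⁻ s in Ioc 0 T, ENNReal.ofReal (coeffBound α) *
          (ENNReal.ofReal (en ξ) * (1 + forcing Uu Vv s ξ ^ 2)) := by
          refine lintegral_mono fun s => (enorm_Qhat_le α (Uu s) (Vv s) ξ j).trans ?_
          exact mul_le_mul_right (mul_le_mul_right (hle _) _) _
      _ = ENNReal.ofReal (coeffBound α) *
          (ENNReal.ofReal (en ξ) * (ENNReal.ofReal T + forcingSq Uu Vv T ξ)) := by
          rw [lintegral_const_mul' _ _ ENNReal.ofReal_ne_top,
            lintegral_const_mul' _ _ ENNReal.ofReal_ne_top, lintegral_add_left measurable_const,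
            setLIntegral_const, Real.volume_Ioc, sub_zero, one_mul]
          rfl
      _ < ⊤ := by finiteness
  exact hQ.continuousOn_mul (by fun_prop)

lemma continuousOn_Bhat (α : Coeffs) (hU : MeasVF Uu) (hV : MeasVF Vv) {T : ℝ}
    (hT : 0 ≤ T) {ξ : V3} (h : forcingSq Uu Vv T ξ < ⊤) (j : Fin 3) :
    ContinuousOn (fun t => Bhat α Uu Vv t ξ j) (Icc 0 T) := by
  have e : ∀ t, Bhat α Uu Vv t ξ j = (Real.exp (-(t * en ξ ^ 2)) : ℂ) *
      ∫ s in (0 : ℝ)..t, (Real.exp (s * en ξ ^ 2) : ℂ) * Qhat α (Uu s) (Vv s) ξ j := fun t => by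
    rw [Bhat, ← intervalIntegral.integral_const_mul]
    refine intervalIntegral.integral_congr fun s _ => ?_
    rw [← mul_assoc, ← Complex.ofReal_mul, ← Real.exp_add]
    congr 3
    ring
  simp only [e]
  have hp := intervalIntegral.continuousOn_primitive_interval'
    (intervalIntegrable_exp_mul_Qhat α hU hV hT h j) left_mem_uIcc
  rw [uIcc_of_le hT] at hp
  exact ContinuousOn.mul (by fun_prop) hp

lemma vnSq_sub_le (x y : Fin 3 → ℂ) : vnSq (fun j => x j - y j) ≤ 2 * vnSq x + 2 * vnSq y := by
  unfold vnSq
  rw [Finset.mul_sum, Finset.mul_sum, ← Finset.sum_add_distrib]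
  refine Finset.sum_le_sum fun j _ => ?_
  nlinarith [norm_sub_le (x j) (y j), norm_nonneg (x j - y j), sq_nonneg (‖x j‖ - ‖y j‖)]

lemma contInW_Bhat (α : Coeffs) (hU : MeasVF Uu) (hV : MeasVF Vv) {T γ δ : ℝ} (hT : 0 < T)
    (hδ : 0 ≤ δ) (hδ1 : δ ≤ 1) (hfin : ∫⁻ ξ, majorant α Uu Vv T γ δ ξ ≠ ⊤) :
    ContInW (wH γ) (Bhat α Uu Vv) T := by
  have hpt : ∀ t ∈ Icc 0 T, ∀ ξ, ENNReal.ofReal (wH γ ξ ^ 2) * ENNReal.ofReal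
      (vnSq (Bhat α Uu Vv t ξ)) ≤ majorant α Uu Vv T γ δ ξ := fun t ht ξ => by
    rw [← magn_sq]
    exact ofReal_mul_magn_Bhat_sq_le α hU hV ht.1 ht.2 hδ hδ1 γ ξ
  refine ⟨fun t ht => ?_, fun t ht ε hε => ?_⟩
  · have := (wnorm_Bhat_sq_le α hU hV ht.1 ht.2 hδ hδ1 γ).trans_lt hfin.lt_top
    exact (ENNReal.pow_lt_top_iff.1 this).resolve_right two_ne_zero
  have hlim : Tendsto (fun s => ∫⁻ ξ, ENNReal.ofReal (wH γ ξ ^ 2 *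
      vnSq (fun j => Bhat α Uu Vv s ξ j - Bhat α Uu Vv t ξ j))) (𝓝[Icc 0 T] t)
      (𝓝 (∫⁻ _ξ : V3, 0)) := by
    refine tendsto_lintegral_filter_of_dominated_convergence
      (fun ξ => 4 * majorant α Uu Vv T γ δ ξ) ?_ ?_ ?_ ?_
    · filter_upwards [self_mem_nhdsWithin] with s hs
      have h1 := measurable_Bhat α hU hV hs.1
      have h2 := measurable_Bhat α hU hV ht.1
      have h3 := measurable_wH γ
      unfold vnSq
      fun_prop
    · filter_upwards [self_mem_nhdsWithin] with s hs
      refine Eventually.of_forall fun ξ => ?_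
      calc _ ≤ ENNReal.ofReal (2 * (wH γ ξ ^ 2 * vnSq (Bhat α Uu Vv s ξ)) +
            2 * (wH γ ξ ^ 2 * vnSq (Bhat α Uu Vv t ξ))) := by
            refine ENNReal.ofReal_le_ofReal ((mul_le_mul_of_nonneg_left
              (vnSq_sub_le _ _) (sq_nonneg _)).trans (le_of_eq (by ring)))
        _ ≤ 2 * majorant α Uu Vv T γ δ ξ + 2 * majorant α Uu Vv T γ δ ξ := by
            refine ENNReal.ofReal_add_le.trans ?_
            rw [ENNReal.ofReal_mul two_pos.le, ENNReal.ofReal_mul two_pos.le,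
              ENNReal.ofReal_mul (sq_nonneg _), ENNReal.ofReal_mul (sq_nonneg _),
              ENNReal.ofReal_ofNat]
            exact add_le_add (mul_le_mul_right (hpt s hs ξ) _) (mul_le_mul_right (hpt t ht ξ) _)
        _ = _ := by ring
    · rw [lintegral_const_mul' _ _ (by finiteness)]
      finiteness
    · filter_upwards [ae_lt_top (measurable_majorant α hU hV T γ δ) hfin] with ξ hξ
      have hc := fun j => continuousOn_Bhat α hU hV hT.le (forcingSq_lt_top_of_majorant hT hξ) j
      have : ContinuousWithinAt (fun s => ENNReal.ofReal (wH γ ξ ^ 2 *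
          vnSq (fun j => Bhat α Uu Vv s ξ j - Bhat α Uu Vv t ξ j))) (Icc 0 T) t := by
        have hc' := fun j => (hc j) t ht
        simp only [vnSq, Fin.sum_univ_three]
        refine ENNReal.continuous_ofReal.continuousAt.comp_continuousWithinAt ?_
        fun_prop
      simpa [ContinuousWithinAt, vnSq] using this
  have hlim' : Tendsto (fun s => wnorm (wH γ) (fun ξ j => Bhat α Uu Vv s ξ j - Bhat α Uu Vv t ξ j))
      (𝓝[Icc 0 T] t) (𝓝 0) := by
    have := hlim.ennrpow_const (1 / 2)
    simpa [wnorm] using this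
  obtain ⟨d, hd, hball⟩ := Metric.mem_nhdsWithin_iff.1 ((tendsto_order.1 hlim').2 ε hε)
  exact ⟨d, hd, fun s hs hst => hball ⟨by rwa [Metric.mem_ball, Real.dist_eq], hs⟩⟩

end Continuity

lemma duhamel_estimates (α : Coeffs) {γ δ p : ℝ} (hγ : 0 ≤ γ) (hδ : 0 ≤ δ) (hδ1 : δ ≤ 1)
    (hp : 4 ≤ p)
    (h : ∃ C : ℝ, 0 ≤ C ∧ ∀ ξ : V3, ∫⁻ η, ENNReal.ofReal (convKer (γ + 2 / p) ξ η)
      ≤ ENNReal.ofReal (C * jb ξ ^ (-(γ + δ)))) :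
    ∃ C > (0 : ℝ), ∀ T : ℝ, 0 < T → T ≤ 1 →
      ∀ Uu Vv : ℝ → V3 → Fin 3 → ℂ, MeasVF Uu → MeasVF Vv →
        LpTW p T (wH (γ + 2 / p)) Uu < ⊤ →
        LpTW p T (wH (γ + 2 / p)) Vv < ⊤ →
        (ContInW (wH γ) (Bhat α Uu Vv) T ∧ MemL2W (wD (γ + 1)) (Bhat α Uu Vv) T) ∧
        ((⨆ t ∈ Icc (0 : ℝ) T, wnorm (wH γ) (Bhat α Uu Vv t)) +
            (∫⁻ t in Ioo (0 : ℝ) T,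
                wnorm (fun ξ => wH γ ξ * en ξ) (Bhat α Uu Vv t) ^ (2 : ℕ)) ^ ((1 : ℝ) / 2)
          ≤ ENNReal.ofReal (C * T ^ ((δ + 1 - 4 / p) / 2)) *
            (LpTW p T (wH (γ + 2 / p)) Uu * LpTW p T (wH (γ + 2 / p)) Vv)) ∧
        LpTW p T (wH (γ + 2 / p)) (Bhat α Uu Vv)
          ≤ ENNReal.ofReal ((C * T ^ ((δ + 1 - 4 / p) / 2)) * (1 + T ^ (1 / p))) *
            (LpTW p T (wH (γ + 2 / p)) Uu * LpTW p T (wH (γ + 2 / p)) Vv) := by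
  obtain ⟨K, hK, hmaj⟩ := exists_lintegral_majorant_le α hp (by positivity) h
  refine ⟨2 * K + 1, by positivity, fun T hT _ Uu Vv hU hV hUfin hVfin => ?_⟩
  obtain ⟨A, hA⟩ : ∃ A, A = LpTW p T (wH (γ + 2 / p)) Uu * LpTW p T (wH (γ + 2 / p)) Vv :=
    ⟨_, rfl⟩
  obtain ⟨R, hR⟩ : ∃ R, R = ENNReal.ofReal (K * T ^ ((δ + 1 - 4 / p) / 2)) * A := ⟨_, rfl⟩
  have hAfin : A ≠ ⊤ := hA ▸ ENNReal.mul_ne_top hUfin.ne hVfin.ne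
  have hRfin : R ≠ ⊤ := hR ▸ ENNReal.mul_ne_top ENNReal.ofReal_ne_top hAfin
  have hS : ∫⁻ ξ, majorant α Uu Vv T γ δ ξ ≤ R ^ 2 := by
    rw [hR, hA]
    exact hmaj T hT Uu Vv hU hV
  have hsup : ∀ t ∈ Icc 0 T, wnorm (wH γ) (Bhat α Uu Vv t) ^ 2 ≤ R ^ 2 := fun t ht =>
    (wnorm_Bhat_sq_le α hU hV ht.1 ht.2 hδ hδ1 γ).trans hS
  have hdis : ∫⁻ t in Ioo 0 T, wnorm (fun ξ => wH γ ξ * en ξ) (Bhat α Uu Vv t) ^ 2 ≤ R ^ 2 :=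
    (lintegral_wnorm_Bhat_sq_le α hU hV hT.le hδ hδ1 γ).trans hS
  have hR2 : R ^ 2 < ⊤ := by finiteness
  have hTp : 0 ≤ T ^ ((δ + 1 - 4 / p) / 2) := by positivity
  have hTp' : 0 ≤ T ^ (1 / p) := by positivity
  rw [← hA]
  refine ⟨⟨contInW_Bhat α hU hV hT hδ hδ1 (hS.trans_lt hR2).ne, ?_⟩, ?_, ?_⟩
  · refine lt_of_le_of_lt (lintegral_mono fun t => ?_) (hdis.trans_lt hR2)
    exact pow_le_pow_left' (wnorm_mono (wD_sq_le hγ) _) 2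
  · calc _ ≤ R + (R ^ 2) ^ ((1 : ℝ) / 2) :=
          add_le_add (iSup₂_le fun t ht => le_of_sq_le_sq_ennreal (hsup t ht))
            (ENNReal.rpow_le_rpow hdis (by norm_num))
      _ = ENNReal.ofReal (2 * (K * T ^ ((δ + 1 - 4 / p) / 2))) * A := by
          rw [← ENNReal.rpow_natCast_mul, ENNReal.ofReal_mul two_pos.le, mul_assoc, ← hR]
          norm_num [two_mul]
      _ ≤ _ := by
          rw [← mul_assoc 2]
          gcongr
          linarith
  · calc _ ≤ ENNReal.ofReal (1 + T ^ (1 / p)) * R :=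
          LpTW_le_of_energy (by linarith) hT.le (fun t ht => measurable_Bhat α hU hV ht.1.le)
            hRfin (fun t ht => hsup t (Ioo_subset_Icc_self ht)) hdis
      _ = ENNReal.ofReal ((K * T ^ ((δ + 1 - 4 / p) / 2)) * (1 + T ^ (1 / p))) * A := by
          rw [hR, ← mul_assoc, ← ENNReal.ofReal_mul (by positivity), mul_comm (1 + _)]
      _ ≤ _ := by
          gcongr
          linarith

/-- Proposition 2.2: estimates for the Duhamel term. -/
theorem statement9 (α : Coeffs) (γ : ℝ) (hγ : 1 / 2 ≤ γ) :
    ∃ C > (0 : ℝ), ∀ T : ℝ, 0 < T → T ≤ 1 →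
      ∀ Uu Vv : ℝ → V3 → Fin 3 → ℂ, MeasVF Uu → MeasVF Vv →
        LpTW (pgam γ) T (wH (γ + 2 / pgam γ)) Uu < ⊤ →
        LpTW (pgam γ) T (wH (γ + 2 / pgam γ)) Vv < ⊤ →
        (ContInW (wH γ) (Bhat α Uu Vv) T ∧ MemL2W (wD (γ + 1)) (Bhat α Uu Vv) T) ∧
        ((⨆ t ∈ Icc (0 : ℝ) T, wnorm (wH γ) (Bhat α Uu Vv t)) +
            (∫⁻ t in Ioo (0 : ℝ) T,
                wnorm (fun ξ => wH γ ξ * en ξ) (Bhat α Uu Vv t) ^ (2 : ℕ)) ^ ((1 : ℝ) / 2)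
          ≤ ENNReal.ofReal
              (if 1 < γ then C * T ^ ((1 : ℝ) / 4) else C * T ^ (1 / 2 - 2 / pgam γ)) *
            (LpTW (pgam γ) T (wH (γ + 2 / pgam γ)) Uu *
              LpTW (pgam γ) T (wH (γ + 2 / pgam γ)) Vv)) ∧
        LpTW (pgam γ) T (wH (γ + 2 / pgam γ)) (Bhat α Uu Vv)
          ≤ ENNReal.ofReal
              ((if 1 < γ then C * T ^ ((1 : ℝ) / 4) else C * T ^ (1 / 2 - 2 / pgam γ)) *
                (1 + T ^ (1 / pgam γ))) *
            (LpTW (pgam γ) T (wH (γ + 2 / pgam γ)) Uu *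
              LpTW (pgam γ) T (wH (γ + 2 / pgam γ)) Vv) := by
  by_cases h1 : 1 < γ
  · have hp : pgam γ = 4 := if_pos h1
    obtain ⟨C, hC, H⟩ := duhamel_estimates α (γ := γ) (δ := 1 / 2) (p := 4) (by linarith)
      (by norm_num) (by norm_num) le_rfl (by
        rw [show γ + 1 / 2 = γ + 2 / 4 by norm_num]
        exact lintegral_convKer_le_of_three_halves_lt (by linarith))
    have he : ((1 : ℝ) / 2 + 1 - 4 / 4) / 2 = 1 / 4 := by norm_num
    simp only [he] at H
    refine ⟨C, hC, ?_⟩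
    simpa only [hp, if_pos h1] using H
  · have hp : pgam γ = 8 / (3 - 2 * γ) := if_neg h1
    have hγ1 : γ ≤ 1 := not_lt.1 h1
    have h2p : 2 / pgam γ = (3 - 2 * γ) / 4 := by
      rw [hp]
      field_simp
      ring
    have hp4 : 4 ≤ pgam γ := by
      rw [hp, le_div_iff₀ (by linarith)]
      linarith
    obtain ⟨C, hC, H⟩ := duhamel_estimates α (γ := γ) (δ := 0) (p := pgam γ) (by linarith)
      le_rfl zero_le_one hp4 (by
        rw [show γ + 0 = 2 * (γ + 2 / pgam γ) - 3 / 2 by rw [h2p]; ring]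
        exact lintegral_convKer_le_of_lt_three_halves (by rw [h2p]; linarith)
          (by rw [h2p]; linarith))
    have he : (0 + 1 - 4 / pgam γ) / 2 = 1 / 2 - 2 / pgam γ := by ring
    simp only [he] at H
    refine ⟨C, hC, ?_⟩
    simpa only [if_neg h1] using H
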